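/- Corollary 3 (GLDPC ensembles). Suppose every VN type t in I_v is a repetition code, i.e., k_t = 1 and B^{(t)}(x,y) = 1 + x y^{q_t} (so p_t = q_t), with the degrees q_t pairwise distinct; let p = min_t q_t be the minimum VN degree and let delta_tilde = delta_{t~} be the fraction of VNs of the unique type t~ with q_{t~} = p. If r > 2 or p > 2, then G(alpha) = (p - p/r - 1) alpha log alpha + K alpha + O(alpha^xi), where K = log(e delta_tilde) + (p/r) log C + (p/psi) log( p int_lambda / e ) and xi = min{rbar/r, chi/psi + 1, 2}. -/

import Mathlib

open Filter Polynomial Finset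
open scoped Classical

/-- An irregular doubly-generalized LDPC (D-GLDPC) code ensemble, specified by:
check-node (CN) types `Fin nc` with lengths `s`, dimensions `hdim`, minimum distances `rd`,
weight enumerator coefficients `A`; variable-node (VN) types `Fin nv` with dimensions `kdim`,
lengths `q`, minimum distances `pd`, input-output weight enumerator coefficients `B`;
and edge fractions `ρ` (CN side) and `lam` (VN side). -/
structure DGLDPC where
  nc : ℕ
  nv : ℕ
  hnc : 0 < nc
  hnv : 0 < nv
  s : Fin nc → ℕ
  hdim : Fin nc → ℕ
  rd : Fin nc → ℕ
  A : Fin nc → ℕ → ℕ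
  kdim : Fin nv → ℕ
  q : Fin nv → ℕ
  pd : Fin nv → ℕ
  B : Fin nv → ℕ → ℕ → ℕ
  ρ : Fin nc → ℝ
  lam : Fin nv → ℝ
  h_hdim : ∀ t, 1 ≤ hdim t
  h_hs : ∀ t, hdim t < s t
  h_rd2 : ∀ t, 2 ≤ rd t
  h_rds : ∀ t, rd t ≤ s t
  hA0 : ∀ t, A t 0 = 1
  hAsupp : ∀ t u, u ≠ 0 → (u < rd t ∨ s t < u) → A t u = 0
  hAr : ∀ t, 0 < A t (rd t)
  h_k1 : ∀ t, 1 ≤ kdim t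
  h_q1 : ∀ t, 1 ≤ q t
  h_pd2 : ∀ t, 2 ≤ pd t
  h_pdq : ∀ t, pd t ≤ q t
  hB00 : ∀ t, B t 0 0 = 1
  hBsupp : ∀ t u v, ¬(u = 0 ∧ v = 0) →
    ¬(1 ≤ u ∧ u ≤ kdim t ∧ pd t ≤ v ∧ v ≤ q t) → B t u v = 0
  hBp : ∀ t, ∃ u, 0 < B t u (pd t)
  hρpos : ∀ t, 0 < ρ t
  hlampos : ∀ t, 0 < lam t
  hρsum : ∑ t, ρ t = 1
  hlamsum : ∑ t, lam t = 1

namespace DGLDPC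

variable (M : DGLDPC)

/-- `∫ρ = ∑_t ρ_t / s_t`. -/
noncomputable def intrho : ℝ := ∑ t, M.ρ t / (M.s t : ℝ)

/-- `∫λ = ∑_t λ_t / q_t`. -/
noncomputable def intlam : ℝ := ∑ t, M.lam t / (M.q t : ℝ)

/-- Fraction `δ_t = λ_t / (q_t ∫λ)` of VNs of type `t`. -/
noncomputable def δfrac (t : Fin M.nv) : ℝ := M.lam t / ((M.q t : ℝ) * M.intlam)

/-- `r`: the smallest CN minimum distance. -/
noncomputable def r : ℕ := sInf (Set.range M.rd)

/-- `p`: the smallest VN minimum distance. -/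
noncomputable def p : ℕ := sInf (Set.range M.pd)

/-- `ψ = r/(r-1)`. -/
noncomputable def ψ : ℝ := (M.r : ℝ) / ((M.r : ℝ) - 1)

/-- `C = r ∑_{t ∈ X_c} ρ_t A_r^{(t)} / s_t`, sum over CN types of minimum distance `r`. -/
noncomputable def Cparam : ℝ :=
  (M.r : ℝ) * ∑ t ∈ Finset.univ.filter (fun t => M.rd t = M.r),
    M.ρ t * (M.A t M.r : ℝ) / (M.s t : ℝ)

/-- `T_{i,j} = (j - ψ)/i`. -/
noncomputable def Tij (i j : ℕ) : ℝ := ((j : ℝ) - M.ψ) / (i : ℝ)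

/-- `S⁻`: pairs `(i,j) ≠ (0,0)` with `B_{i,j}^{(t)} > 0` for some VN type `t`. -/
def Sminus : Set (ℕ × ℕ) := {ij | (∃ t, 0 < M.B t ij.1 ij.2) ∧ ij ≠ (0, 0)}

/-- `T = min_{(i,j) ∈ S⁻} T_{i,j}`. -/
noncomputable def T : ℝ := sInf {x : ℝ | ∃ ij ∈ M.Sminus, x = M.Tij ij.1 ij.2}

/-- The set of candidate exponents whose infimum is
`ξ = min { r̄/r, χ/ψ + 1, 2 }` (terms coming from empty families being dropped):
it contains `2`, the values `i/r` for `i > r` with `A_i^{(t)} > 0` for some `t`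
(whose minimum is `r̄/r`), and the values `(T_{i,j} - T) i / ψ + 1` for `(i,j) ∈ S⁻`
with `T_{i,j} > T` (whose minimum is `χ/ψ + 1`). -/
noncomputable def xiSet : Set ℝ :=
  {2} ∪ {x : ℝ | ∃ i : ℕ, M.r < i ∧ (∃ t, 0 < M.A t i) ∧ x = (i : ℝ) / (M.r : ℝ)}
    ∪ {x : ℝ | ∃ ij ∈ M.Sminus, M.T < M.Tij ij.1 ij.2 ∧
        x = (M.Tij ij.1 ij.2 - M.T) * (ij.1 : ℝ) / M.ψ + 1}

/-- The exponent `ξ = min { r̄/r, χ/ψ + 1, 2 }`. -/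
noncomputable def ξexp : ℝ := sInf M.xiSet

/-- The polynomial `Q₁(x)`; the sum effectively ranges over `t ∈ Y_v` and `(i,j) ∈ P_t`,
i.e. over all `(t,i,j)` with `(i,j) ∈ S_t⁻` and `T_{i,j} = T`. -/
noncomputable def Q1 (x : ℝ) : ℝ :=
  ∑ t, (M.lam t / (M.q t : ℝ)) *
    ∑ i ∈ Finset.range (M.kdim t + 1), ∑ j ∈ Finset.range (M.q t + 1),
      if 0 < M.B t i j ∧ (i, j) ≠ (0, 0) ∧ M.Tij i j = M.T then
        (j : ℝ) * (M.B t i j : ℝ) * M.Cparam ^ ((j : ℝ) / (M.r : ℝ)) *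
          (M.intlam / Real.exp 1) ^ ((i : ℝ) * M.T / M.ψ) * x ^ i
      else 0

/-- The polynomial `Q₂(x)`. -/
noncomputable def Q2 (x : ℝ) : ℝ :=
  ∑ t, (M.lam t / (M.q t : ℝ)) *
    ∑ i ∈ Finset.range (M.kdim t + 1), ∑ j ∈ Finset.range (M.q t + 1),
      if 0 < M.B t i j ∧ (i, j) ≠ (0, 0) ∧ M.Tij i j = M.T then
        (i : ℝ) * (M.B t i j : ℝ) * M.Cparam ^ ((j : ℝ) / (M.r : ℝ)) *
          (M.intlam / Real.exp 1) ^ ((i : ℝ) * M.T / M.ψ) * x ^ i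
      else 0

/-- Number of Tanner graph edges, `E = n/∫λ` (exact on admissible `n`). -/
noncomputable def En (n : ℕ) : ℕ := ⌊(n : ℝ) / M.intlam⌋₊

/-- Number of CNs of type `t`, `γ_t m = E ρ_t / s_t` (exact on admissible `n`). -/
noncomputable def cExp (n : ℕ) (t : Fin M.nc) : ℕ := ⌊(M.En n : ℝ) * M.ρ t / (M.s t : ℝ)⌋₊

/-- Number of VNs of type `t`, `δ_t n = E λ_t / q_t` (exact on admissible `n`). -/
noncomputable def vExp (n : ℕ) (t : Fin M.nv) : ℕ := ⌊(M.En n : ℝ) * M.lam t / (M.q t : ℝ)⌋₊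

/-- The CN weight enumerating polynomial `A^{(t)}(x)`. -/
noncomputable def Apoly (t : Fin M.nc) : Polynomial ℝ :=
  ∑ u ∈ Finset.range (M.s t + 1), Polynomial.C ((M.A t u : ℕ) : ℝ) * Polynomial.X ^ u

/-- The VN bivariate weight enumerating polynomial `B^{(t)}(x,y)`, with the outer
variable recording input weight and the inner variable recording output weight. -/
noncomputable def Bpoly (t : Fin M.nv) : Polynomial (Polynomial ℝ) :=
  ∑ u ∈ Finset.range (M.kdim t + 1),
    Polynomial.C (∑ v ∈ Finset.range (M.q t + 1),
      Polynomial.C ((M.B t u v : ℕ) : ℝ) * Polynomial.X ^ v) * Polynomial.X ^ u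

/-- `N_c(v)`: the number of check-valid assignments of weight `v`, i.e. the coefficient
of `x^v` in `∏_t (A^{(t)}(x))^{γ_t m}`. -/
noncomputable def NcCount (n v : ℕ) : ℝ := (∏ t, M.Apoly t ^ M.cExp n t).coeff v

/-- `N_v(u,v)`: the coefficient of `x^u y^v` in `∏_t (B^{(t)}(x,y))^{δ_t n}`. -/
noncomputable def NvCount (n u v : ℕ) : ℝ := ((∏ t, M.Bpoly t ^ M.vExp n t).coeff u).coeff v

/-- The expected number of codewords of weight `w`:
`E[N_w] = ∑_v N_v(w,v) N_c(v) / binom(E,v)`. -/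
noncomputable def ENw (n w : ℕ) : ℝ :=
  ∑ v ∈ Finset.range (M.En n + 1),
    M.NvCount n w v * M.NcCount n v / ((M.En n).choose v : ℝ)

/-- `n` is admissible for `α` when all the relevant quantities (`E`, the numbers of
CNs and VNs of each type, and the codeword weight `α n`) are integers and the
expected number of weight-`α n` codewords is positive. -/
def Adm (α : ℝ) (n : ℕ) : Prop :=
  0 < n ∧ ((M.En n : ℝ) = (n : ℝ) / M.intlam) ∧
  (∀ t, (M.cExp n t : ℝ) = (M.En n : ℝ) * M.ρ t / (M.s t : ℝ)) ∧
  (∀ t, (M.vExp n t : ℝ) = (M.En n : ℝ) * M.lam t / (M.q t : ℝ)) ∧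
  ((⌊α * (n : ℝ)⌋₊ : ℝ) = α * (n : ℝ)) ∧
  0 < M.ENw n ⌊α * (n : ℝ)⌋₊

/-- The sequence `(1/n) log E[N_{αn}]` whose limit (along admissible `n`) is `G(α)`. -/
noncomputable def grSeq (α : ℝ) (n : ℕ) : ℝ :=
  (1 / (n : ℝ)) * Real.log (M.ENw n ⌊α * (n : ℝ)⌋₊)

end DGLDPC


namespace Cor3

theorem log_fact_upper (k : ℕ) (hk : 1 ≤ k) :
    Real.log (k.factorial : ℝ) ≤ k * Real.log k - k + Real.log k + 1 := by
  obtain ⟨m, rfl⟩ : ∃ m, k = m + 1 := ⟨k - 1, by omega⟩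
  have h1 := Stirling.log_stirlingSeq'_antitone (Nat.zero_le m)
  simp only [Function.comp] at h1
  have h2 := Stirling.log_stirlingSeq_formula (m + 1)
  have h3 := Stirling.log_stirlingSeq_formula (0 + 1)
  simp only [Nat.succ_eq_add_one] at h1
  rw [h2, h3] at h1
  have hpos : (0 : ℝ) < ((m + 1 : ℕ) : ℝ) := by positivity
  rw [Real.log_mul (by norm_num) hpos.ne', Real.log_div hpos.ne' (Real.exp_pos 1).ne',
    Real.log_exp] at h1
  have h4 : 0 ≤ Real.log ((m + 1 : ℕ) : ℝ) := Real.log_natCast_nonneg _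
  simp at h1
  push_cast at h1 h4 ⊢
  nlinarith [h1]

theorem log_fact_lower (k : ℕ) (hk : 1 ≤ k) :
    (k : ℝ) * Real.log k - k ≤ Real.log (k.factorial : ℝ) := by
  have h := Stirling.le_log_factorial_stirling (n := k) (by omega)
  have h4 : 0 ≤ Real.log (k : ℝ) := Real.log_natCast_nonneg _
  have h5 : 0 ≤ Real.log (2 * Real.pi) := Real.log_nonneg (by nlinarith [Real.pi_gt_three])
  linarith

/-- nonnegative coefficients -/
def nn (P : ℝ[X]) : Prop := ∀ i, 0 ≤ P.coeff i

theorem nn_mul {P Q : ℝ[X]} (hP : nn P) (hQ : nn Q) : nn (P * Q) := by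
  intro i
  rw [coeff_mul]
  exact Finset.sum_nonneg fun x _ => mul_nonneg (hP _) (hQ _)

theorem nn_add {P Q : ℝ[X]} (hP : nn P) (hQ : nn Q) : nn (P + Q) := by
  intro i
  rw [coeff_add]
  exact add_nonneg (hP _) (hQ _)

theorem nn_one : nn (1 : ℝ[X]) := by
  intro i
  rw [coeff_one]; split_ifs <;> norm_num

theorem nn_pow {P : ℝ[X]} (hP : nn P) (k : ℕ) : nn (P ^ k) := by
  induction k with
  | zero => simpa using nn_one
  | succ k ih => rw [pow_succ]; exact nn_mul ih hP

theorem nn_prod {ι : Type*} (s : Finset ι) (f : ι → ℝ[X]) (hf : ∀ i ∈ s, nn (f i)) :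
    nn (∏ i ∈ s, f i) := by
  induction s using Finset.induction_on with
  | empty => simpa using nn_one
  | insert a s ha ih =>
    rw [Finset.prod_insert ha]
    exact nn_mul (hf _ (by simp)) (ih fun i hi => hf i (by simp [hi]))

theorem nn_super {P Q : ℝ[X]} (hP : nn P) (hQ : nn Q) (a b : ℕ) :
    P.coeff a * Q.coeff b ≤ (P * Q).coeff (a + b) := by
  rw [coeff_mul]
  exact Finset.single_le_sum (f := fun x : ℕ × ℕ => P.coeff x.1 * Q.coeff x.2)
    (fun x _ => mul_nonneg (hP _) (hQ _)) (Finset.HasAntidiagonal.mem_antidiagonal.mpr rfl : (a, b) ∈ _)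

theorem nn_super_pow {P : ℝ[X]} (hP : nn P) (a k : ℕ) :
    P.coeff a ^ k ≤ (P ^ k).coeff (k * a) := by
  induction k with
  | zero => simp
  | succ k ih =>
    rw [pow_succ, pow_succ, add_mul, one_mul]
    exact (mul_le_mul_of_nonneg_right ih (hP a)).trans (nn_super (nn_pow hP k) hP _ _)

theorem nn_eval {P : ℝ[X]} (hP : nn P) {x : ℝ} (hx : 0 ≤ x) (a : ℕ) :
    P.coeff a * x ^ a ≤ P.eval x := by
  by_cases ha : a ∈ P.support
  · rw [eval_eq_sum, Polynomial.sum]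
    exact Finset.single_le_sum (f := fun i => P.coeff i * x ^ i)
      (fun i _ => mul_nonneg (hP _) (pow_nonneg hx _)) ha
  · rw [notMem_support_iff.mp ha, zero_mul, eval_eq_sum, Polynomial.sum]
    exact Finset.sum_nonneg fun i _ => mul_nonneg (hP _) (pow_nonneg hx _)

theorem nn_eval_sum {P : ℝ[X]} (hP : nn P) {x : ℝ} (hx : 0 ≤ x) (s : Finset ℕ) :
    ∑ a ∈ s, P.coeff a * x ^ a ≤ P.eval x := by
  rw [eval_eq_sum, Polynomial.sum]
  have : ∑ a ∈ s, P.coeff a * x ^ a = ∑ a ∈ s.filter (· ∈ P.support), P.coeff a * x ^ a := by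
    rw [Finset.sum_filter]
    refine Finset.sum_congr rfl fun a _ => ?_
    split_ifs with h
    · rfl
    · rw [notMem_support_iff.mp h, zero_mul]
  rw [this]
  exact Finset.sum_le_sum_of_subset_of_nonneg (fun a ha => (Finset.mem_filter.mp ha).2)
    fun i _ _ => mul_nonneg (hP _) (pow_nonneg hx _)

theorem cle_prod {ι : Type*} (s : Finset ι) (f g : ι → ℝ[X]) (hf : ∀ i ∈ s, nn (f i))
    (hfg : ∀ i ∈ s, nn (g i - f i)) : nn (∏ i ∈ s, g i - ∏ i ∈ s, f i) := by
  induction s using Finset.induction_on with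
  | empty => intro i; simp
  | insert a s ha ih =>
    rw [Finset.prod_insert ha, Finset.prod_insert ha]
    have e : g a * ∏ i ∈ s, g i - f a * ∏ i ∈ s, f i =
      (g a - f a) * ∏ i ∈ s, g i + f a * (∏ i ∈ s, g i - ∏ i ∈ s, f i) := by ring
    rw [e]
    have hg : nn (∏ i ∈ s, g i) := nn_prod _ _ fun i hi => by
      have := nn_add (hf i (by simp [hi])) (hfg i (by simp [hi]))
      simpa using this
    exact nn_add (nn_mul (hfg a (by simp)) hg) (nn_mul (hf a (by simp))
      (ih (fun i hi => hf i (by simp [hi])) (fun i hi => hfg i (by simp [hi]))))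

/-- differential inequality -/
def RR (A : ℝ) (F : ℝ[X]) (S : ℝ) : Prop :=
  nn F ∧ nn (derivative F * (1 + C A * X) - C S * F)

theorem RR_mul {A : ℝ} {F G : ℝ[X]} {S S' : ℝ} (hF : RR A F S) (hG : RR A G S') :
    RR A (F * G) (S + S') := by
  refine ⟨nn_mul hF.1 hG.1, ?_⟩
  have e : derivative (F * G) * (1 + C A * X) - C (S + S') * (F * G) =
    (derivative F * (1 + C A * X) - C S * F) * G +
      F * (derivative G * (1 + C A * X) - C S' * G) := by
    rw [derivative_mul, C_add]; ring
  rw [e]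
  exact nn_add (nn_mul hF.2 hG.1) (nn_mul hF.1 hG.2)

theorem RR_one (A : ℝ) : RR A 1 0 := by
  refine ⟨nn_one, ?_⟩
  intro i; simp

theorem RR_pow {A : ℝ} {F : ℝ[X]} {S : ℝ} (hF : RR A F S) (k : ℕ) : RR A (F ^ k) (k * S) := by
  induction k with
  | zero => simpa using RR_one A
  | succ k ih =>
    have := RR_mul ih hF
    rw [pow_succ]; convert this using 1; push_cast; ring

theorem RR_prod {A : ℝ} {ι : Type*} (s : Finset ι) (f : ι → ℝ[X]) (S : ι → ℝ)
    (hf : ∀ i ∈ s, RR A (f i) (S i)) : RR A (∏ i ∈ s, f i) (∑ i ∈ s, S i) := by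
  induction s using Finset.induction_on with
  | empty => simpa using RR_one A
  | insert a s ha ih =>
    rw [Finset.prod_insert ha, Finset.sum_insert ha]
    exact RR_mul (hf _ (by simp)) (ih fun i hi => hf i (by simp [hi]))

theorem nn_monomial {a : ℝ} (ha : 0 ≤ a) (k : ℕ) : nn (C a * X ^ k) := by
  intro i
  rw [coeff_C_mul_X_pow]; split_ifs <;> simp [ha]

theorem RR_lin {A a : ℝ} (ha : 0 ≤ a) (haA : a ≤ A) : RR A (1 + C a * X) a := by
  refine ⟨nn_add nn_one (by simpa using nn_monomial ha 1), ?_⟩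
  have e : derivative (1 + C a * X) * (1 + C A * X) - C a * (1 + C a * X) =
    C (a * (A - a)) * X ^ 1 := by
    simp; ring
  rw [e]
  exact nn_monomial (mul_nonneg ha (by linarith)) 1

theorem RR_coeff {A : ℝ} {F : ℝ[X]} {S : ℝ} (hF : RR A F S) (k : ℕ) :
    (S - A * k) * F.coeff k ≤ (k + 1) * F.coeff (k + 1) := by
  have h := hF.2 k
  have e : derivative F * (1 + C A * X) - C S * F =
    derivative F + C A * (derivative F * X) - C S * F := by ring
  rw [e, coeff_sub, coeff_add, coeff_C_mul, coeff_C_mul, coeff_derivative] at h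
  rcases k with _ | k
  · simp at h ⊢; linarith
  · rw [coeff_mul_X, coeff_derivative] at h
    push_cast at h ⊢
    linarith

theorem RR_lower {A : ℝ} (hA : 0 ≤ A) {F : ℝ[X]} {S : ℝ} (hF : RR A F S) (h0 : F.coeff 0 = 1)
    (u : ℕ) (hu : A * u ≤ S) : ∀ j ≤ u, (S - A * u) ^ j / (j.factorial : ℝ) ≤ F.coeff j := by
  intro j
  induction j with
  | zero => intro _; simp [h0]
  | succ j ih =>
    intro hj
    have h1 := ih (by omega)
    have h2 := RR_coeff hF j
    have h3 : A * j ≤ A * u := mul_le_mul_of_nonneg_left (by exact_mod_cast (by omega : j ≤ u)) hA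
    have h4 : (S - A * u) * ((S - A * u) ^ j / (j.factorial : ℝ)) ≤ (S - A * j) * F.coeff j :=
      mul_le_mul (by linarith) h1 (div_nonneg (pow_nonneg (by linarith) _) (by positivity))
        (by linarith)
    rw [Nat.factorial_succ, pow_succ]
    push_cast
    rw [div_le_iff₀ (by positivity)]
    have h5 := h4.trans h2
    rw [← mul_div_assoc, div_le_iff₀ (by positivity)] at h5
    nlinarith [h5]

/-- bivariate good class -/
def bb (a b : ℕ) (Q : ℝ[X][X]) : Prop :=
  ∀ u v, 0 ≤ (Q.coeff u).coeff v ∧ ((Q.coeff u).coeff v ≠ 0 → a * u ≤ v ∧ v ≤ b * u)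

theorem bcoeff_mul (P Q : ℝ[X][X]) (u v : ℕ) : ((P * Q).coeff u).coeff v =
    ∑ x ∈ Finset.HasAntidiagonal.antidiagonal u, ∑ y ∈ Finset.HasAntidiagonal.antidiagonal v,
      (P.coeff x.1).coeff y.1 * (Q.coeff x.2).coeff y.2 := by
  rw [coeff_mul, finsetSum_coeff]
  exact Finset.sum_congr rfl fun x _ => coeff_mul _ _ _

theorem bb_mul {a b : ℕ} {P Q : ℝ[X][X]} (hP : bb a b P) (hQ : bb a b Q) : bb a b (P * Q) := by
  intro u v
  rw [bcoeff_mul]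
  refine ⟨Finset.sum_nonneg fun x _ => Finset.sum_nonneg fun y _ =>
    mul_nonneg (hP _ _).1 (hQ _ _).1, fun h => ?_⟩
  obtain ⟨x, hx, h⟩ := Finset.exists_ne_zero_of_sum_ne_zero h
  obtain ⟨y, hy, h⟩ := Finset.exists_ne_zero_of_sum_ne_zero h
  rw [Finset.HasAntidiagonal.mem_antidiagonal] at hx hy
  have h1 := (hP _ _).2 (left_ne_zero_of_mul h)
  have h2 := (hQ _ _).2 (right_ne_zero_of_mul h)
  rw [← hx, ← hy, mul_add, mul_add]
  omega

theorem bb_one (a b : ℕ) : bb a b 1 := by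
  intro u v
  rw [coeff_one]
  split_ifs with h
  · rw [coeff_one]
    split_ifs with h' <;> simp [h, h']
  · simp

theorem bb_pow {a b : ℕ} {P : ℝ[X][X]} (hP : bb a b P) (k : ℕ) : bb a b (P ^ k) := by
  induction k with
  | zero => simpa using bb_one a b
  | succ k ih => rw [pow_succ]; exact bb_mul ih hP

theorem bb_prod {a b : ℕ} {ι : Type*} (s : Finset ι) (f : ι → ℝ[X][X])
    (hf : ∀ i ∈ s, bb a b (f i)) : bb a b (∏ i ∈ s, f i) := by
  induction s using Finset.induction_on with
  | empty => simpa using bb_one a b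
  | insert c s hc ih =>
    rw [Finset.prod_insert hc]
    exact bb_mul (hf _ (by simp)) (ih fun i hi => hf i (by simp [hi]))

theorem bb_super {a b : ℕ} {P Q : ℝ[X][X]} (hP : bb a b P) (hQ : bb a b Q) (u v u' v' : ℕ) :
    (P.coeff u).coeff v * (Q.coeff u').coeff v' ≤ ((P * Q).coeff (u + u')).coeff (v + v') := by
  rw [bcoeff_mul]
  refine le_trans ?_ (Finset.single_le_sum (f := fun x : ℕ × ℕ => ∑ y ∈ Finset.HasAntidiagonal.antidiagonal (v + v'),
      (P.coeff x.1).coeff y.1 * (Q.coeff x.2).coeff y.2)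
    (fun x _ => Finset.sum_nonneg fun y _ => mul_nonneg (hP _ _).1 (hQ _ _).1)
    (Finset.HasAntidiagonal.mem_antidiagonal.mpr rfl : (u, u') ∈ _))
  exact Finset.single_le_sum (f := fun y : ℕ × ℕ => (P.coeff u).coeff y.1 * (Q.coeff u').coeff y.2)
    (fun y _ => mul_nonneg (hP _ _).1 (hQ _ _).1)
    (Finset.HasAntidiagonal.mem_antidiagonal.mpr rfl : (v, v') ∈ _)

theorem bb_super_pow {a b : ℕ} {P : ℝ[X][X]} (hP : bb a b P) (u v k : ℕ) :
    (P.coeff u).coeff v ^ k ≤ ((P ^ k).coeff (k * u)).coeff (k * v) := by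
  induction k with
  | zero => simp
  | succ k ih =>
    rw [pow_succ, pow_succ, add_mul, one_mul, add_mul, one_mul]
    exact (mul_le_mul_of_nonneg_right ih (hP u v).1).trans (bb_super (bb_pow hP k) hP _ _ _ _)

/-- limit existence -/
theorem limit_exists (S : Set ℕ) (a e : ℕ → ℝ) (hS : S.Nonempty)
    (he : ∀ n, 0 ≤ e n) (he0 : Tendsto e atTop (nhds 0))
    (B : ℝ) (hB : ∀ n ∈ S, a n ≤ B)
    (hsup : ∀ n ∈ S, ∀ ε > 0, ∃ N, ∀ n' ∈ S, N ≤ n' → a n - e n - ε ≤ a n') :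
    ∃ G, Tendsto a (atTop ⊓ principal S) (nhds G) := by
  set L := sSup ((fun n => a n - e n) '' S)
  have hbdd : BddAbove ((fun n => a n - e n) '' S) :=
    ⟨B, by rintro _ ⟨n, hn, rfl⟩; have := hB n hn; have := he n; dsimp; linarith⟩
  refine ⟨L, ?_⟩
  rw [Metric.tendsto_nhds]
  intro ε hε
  obtain ⟨_, ⟨n, hn, rfl⟩, hn2⟩ := exists_lt_of_lt_csSup (hS.image (fun n => a n - e n))
    (show L - ε / 2 < L by linarith)
  obtain ⟨N, hN⟩ := hsup n hn (ε / 2) (by linarith)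
  rw [eventually_inf_principal]
  filter_upwards [eventually_ge_atTop N, he0.eventually (gt_mem_nhds hε)] with n' h1 h2 h3
  have h4 := hN n' h3 h1
  have h5 : a n' - e n' ≤ L := le_csSup hbdd ⟨n', h3, rfl⟩
  rw [Real.dist_eq, abs_lt]
  constructor
  · dsimp at hn2; linarith
  · linarith

end Cor3


namespace Cor3

theorem il_pos (M : DGLDPC) : 0 < M.intlam := by
  unfold DGLDPC.intlam
  have : Nonempty (Fin M.nv) := ⟨⟨0, M.hnv⟩⟩
  exact Finset.sum_pos (fun t _ => div_pos (M.hlampos t)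
    (by exact_mod_cast M.h_q1 t)) Finset.univ_nonempty

theorem r_le (M : DGLDPC) (t : Fin M.nc) : M.r ≤ M.rd t := Nat.sInf_le ⟨t, rfl⟩

theorem r_mem (M : DGLDPC) : ∃ t, M.rd t = M.r :=
  Nat.sInf_mem (s := Set.range M.rd) ⟨_, ⟨⟨0, M.hnc⟩, rfl⟩⟩

theorem two_le_r (M : DGLDPC) : 2 ≤ M.r := by
  obtain ⟨t, ht⟩ := r_mem M
  rw [← ht]; exact M.h_rd2 t

theorem p_le (M : DGLDPC) (hpd : ∀ t, M.pd t = M.q t) (t : Fin M.nv) : M.p ≤ M.q t := by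
  rw [← hpd]; exact Nat.sInf_le ⟨t, rfl⟩

theorem two_le_p (M : DGLDPC) : 2 ≤ M.p := by
  obtain ⟨t, ht⟩ : ∃ t, M.pd t = M.p :=
    Nat.sInf_mem (s := Set.range M.pd) ⟨_, ⟨⟨0, M.hnv⟩, rfl⟩⟩
  rw [← ht]; exact M.h_pd2 t

theorem s_pos (M : DGLDPC) (t : Fin M.nc) : (0 : ℝ) < M.s t := by
  have := M.h_hs t
  exact_mod_cast (by omega : 0 < M.s t)

theorem q_pos (M : DGLDPC) (t : Fin M.nv) : (0 : ℝ) < M.q t := by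
  exact_mod_cast M.h_q1 t

theorem A_zero (M : DGLDPC) (t : Fin M.nc) (u : ℕ) (h0 : u ≠ 0) (hu : u < M.r) : M.A t u = 0 :=
  M.hAsupp t u h0 (Or.inl (lt_of_lt_of_le hu (r_le M t)))

theorem C_eq (M : DGLDPC) :
    M.Cparam = M.r * ∑ t, M.ρ t * (M.A t M.r : ℝ) / (M.s t : ℝ) := by
  unfold DGLDPC.Cparam
  congr 1
  rw [Finset.sum_filter]
  refine Finset.sum_congr rfl fun t _ => ?_
  split_ifs with h
  · rfl
  · have h2 := two_le_r M
    rw [M.hAsupp t M.r (by omega) (Or.inl (lt_of_le_of_ne (r_le M t) (Ne.symm h)))]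
    simp

theorem C_pos (M : DGLDPC) : 0 < M.Cparam := by
  have h2 := two_le_r M
  unfold DGLDPC.Cparam
  refine mul_pos (by exact_mod_cast (by omega : 0 < M.r)) (Finset.sum_pos (fun t ht => ?_) ?_)
  · rw [Finset.mem_filter] at ht
    have := M.hAr t
    rw [ht.2] at this
    exact div_pos (mul_pos (M.hρpos t) (by exact_mod_cast this)) (s_pos M t)
  · obtain ⟨t, ht⟩ := r_mem M
    exact ⟨t, by simp [ht]⟩

theorem psi_inv (M : DGLDPC) : M.ψ⁻¹ = 1 - 1 / (M.r : ℝ) := by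
  have h2 : (2 : ℝ) ≤ M.r := by exact_mod_cast two_le_r M
  unfold DGLDPC.ψ
  rw [inv_div]; field_simp

theorem psi_pos (M : DGLDPC) : 0 < M.ψ := by
  have h2 : (2 : ℝ) ≤ M.r := by exact_mod_cast two_le_r M
  unfold DGLDPC.ψ
  exact div_pos (by linarith) (by linarith)

theorem Bpoly_eq (M : DGLDPC) (hk : ∀ t, M.kdim t = 1)
    (hB : ∀ t u v, M.B t u v = if (u = 0 ∧ v = 0) ∨ (u = 1 ∧ v = M.q t) then 1 else 0)
    (t : Fin M.nv) : M.Bpoly t = 1 + C (X ^ M.q t) * X := by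
  unfold DGLDPC.Bpoly
  rw [hk, Finset.sum_range_succ, Finset.sum_range_one]
  congr 1
  · rw [pow_zero, mul_one, ← C_1]
    congr 1
    rw [Finset.sum_eq_single 0]
    · simp [hB]
    · intro b _ hb
      simp [hB, hb]
    · simp
  · rw [pow_one]
    congr 2
    rw [Finset.sum_eq_single (M.q t)]
    · simp [hB]
    · intro b _ hb
      simp [hB, hb]
    · simp

theorem mem_S (M : DGLDPC)
    (hB : ∀ t u v, M.B t u v = if (u = 0 ∧ v = 0) ∨ (u = 1 ∧ v = M.q t) then 1 else 0)
    (ij : ℕ × ℕ) : ij ∈ M.Sminus ↔ ∃ t, ij = (1, M.q t) := by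
  obtain ⟨i, j⟩ := ij
  unfold DGLDPC.Sminus
  simp only [Set.mem_ofPred_eq, Prod.mk.injEq, ne_eq, not_and, hB]
  constructor
  · rintro ⟨⟨t, ht⟩, h⟩
    refine ⟨t, ?_⟩
    by_contra hc
    rw [if_neg] at ht
    · omega
    · rintro (h1 | h1)
      · exact h h1.1 h1.2
      · exact hc h1
  · rintro ⟨t, h1, h2⟩
    refine ⟨⟨t, by simp [h1, h2]⟩, by omega⟩

theorem T_eq (M : DGLDPC) (hpd : ∀ t, M.pd t = M.q t)
    (hB : ∀ t u v, M.B t u v = if (u = 0 ∧ v = 0) ∨ (u = 1 ∧ v = M.q t) then 1 else 0)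
    (t0 : Fin M.nv) (ht0 : M.q t0 = M.p) : M.T = M.p - M.ψ := by
  unfold DGLDPC.T
  refine IsLeast.csInf_eq ⟨⟨(1, M.q t0), (mem_S M hB _).2 ⟨t0, rfl⟩, ?_⟩, ?_⟩
  · simp [DGLDPC.Tij, ht0]
  · rintro x ⟨ij, hij, rfl⟩
    obtain ⟨t, rfl⟩ := (mem_S M hB _).1 hij
    have : (M.p : ℝ) ≤ M.q t := by exact_mod_cast p_le M hpd t
    simp [DGLDPC.Tij, this]

theorem xi_bdd (M : DGLDPC) : BddBelow M.xiSet := by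
  refine ⟨0, ?_⟩
  rintro x ((hx | ⟨i, -, -, rfl⟩) | ⟨ij, -, h, rfl⟩)
  · rw [Set.mem_singleton_iff] at hx; rw [hx]; norm_num
  · positivity
  · have := psi_pos M
    have h2 : 0 ≤ M.Tij ij.1 ij.2 - M.T := by linarith
    positivity

theorem xi_le_two (M : DGLDPC) : M.ξexp ≤ 2 :=
  csInf_le (xi_bdd M) (Or.inl (Or.inl rfl))

theorem xi_le_A (M : DGLDPC) (t : Fin M.nc) (i : ℕ) (hi : M.r < i) (hA : 0 < M.A t i) :
    M.ξexp ≤ (i : ℝ) / M.r :=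
  csInf_le (xi_bdd M) (Or.inl (Or.inr ⟨i, hi, ⟨t, hA⟩, rfl⟩))

theorem xi_le_q (M : DGLDPC) (hpd : ∀ t, M.pd t = M.q t)
    (hB : ∀ t u v, M.B t u v = if (u = 0 ∧ v = 0) ∨ (u = 1 ∧ v = M.q t) then 1 else 0)
    (t0 : Fin M.nv) (ht0 : M.q t0 = M.p) (t : Fin M.nv) (ht : M.p < M.q t) :
    M.ξexp ≤ ((M.q t : ℝ) - M.p) / M.ψ + 1 := by
  have hc : (M.p : ℝ) < M.q t := by exact_mod_cast ht
  refine csInf_le (xi_bdd M) (Or.inr ⟨(1, M.q t), (mem_S M hB _).2 ⟨t, rfl⟩, ?_, ?_⟩)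
  · rw [T_eq M hpd hB t0 ht0]; simp [DGLDPC.Tij, hc]
  · rw [T_eq M hpd hB t0 ht0]; simp [DGLDPC.Tij]

theorem rpow_xi_le {α ξ x : ℝ} (h0 : 0 < α) (h1 : α ≤ 1) (h : ξ ≤ x) : α ^ x ≤ α ^ ξ :=
  Real.rpow_le_rpow_of_exponent_ge h0 h1 h

theorem coeff_Apoly (M : DGLDPC) (t : Fin M.nc) (i : ℕ) : (M.Apoly t).coeff i = M.A t i := by
  unfold DGLDPC.Apoly
  rw [finsetSum_coeff]
  simp only [coeff_C_mul_X_pow]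
  rw [Finset.sum_ite_eq]
  split_ifs with h
  · rfl
  · rw [Finset.mem_range] at h
    rw [M.hAsupp t i (by omega) (Or.inr (by omega))]; simp

theorem nn_Apoly (M : DGLDPC) (t : Fin M.nc) : nn (M.Apoly t) := by
  intro i; rw [coeff_Apoly]; positivity

theorem nn_P (M : DGLDPC) (c : Fin M.nc → ℕ) : nn (∏ t, M.Apoly t ^ c t) :=
  nn_prod _ _ fun t _ => nn_pow (nn_Apoly M t) _

/-- max degree bound -/
noncomputable def Qm (M : DGLDPC) : ℕ := ∑ t, M.q t

theorem q_le_Qm (M : DGLDPC) (t : Fin M.nv) : M.q t ≤ Qm M :=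
  Finset.single_le_sum (f := M.q) (fun _ _ => Nat.zero_le _) (Finset.mem_univ t)

theorem bb_lin {a b q : ℕ} (h1 : a ≤ q) (h2 : q ≤ b) : bb a b (1 + C (X ^ q) * X) := by
  intro u v
  rw [coeff_add, coeff_add, coeff_one, coeff_C_mul, coeff_X]
  rcases u with _ | _ | u
  · simp [coeff_one]; split_ifs <;> simp_all
  · simp [coeff_X_pow]
    split_ifs with h
    · subst h; simp; omega
    · simp [h]
  · simp

theorem bb_B (M : DGLDPC) (hk : ∀ t, M.kdim t = 1) (hpd : ∀ t, M.pd t = M.q t)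
    (hB : ∀ t u v, M.B t u v = if (u = 0 ∧ v = 0) ∨ (u = 1 ∧ v = M.q t) then 1 else 0)
    (c : Fin M.nv → ℕ) : bb M.p (Qm M) (∏ t, M.Bpoly t ^ c t) :=
  bb_prod _ _ fun t _ => bb_pow (by
    rw [Bpoly_eq M hk hB]; exact bb_lin (p_le M hpd t) (q_le_Qm M t)) _

/-- main term -/
noncomputable def mainT (M : DGLDPC) (δ α : ℝ) : ℝ :=
  (M.p * α / M.ψ) * (Real.log (M.p * M.intlam * α) - 1) + (M.p * α / M.r) * Real.log M.Cparam
    + α * Real.log (δ / α) + α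

theorem main_eq (M : DGLDPC) (δ α : ℝ) (hδ : 0 < δ) (hα : 0 < α) :
    mainT M δ α = (((M.p : ℝ) - (M.p : ℝ) / (M.r : ℝ) - 1) * α * Real.log α +
              (Real.log (Real.exp 1 * δ) +
                ((M.p : ℝ) / (M.r : ℝ)) * Real.log M.Cparam +
                ((M.p : ℝ) / M.ψ) * Real.log ((M.p : ℝ) * M.intlam / Real.exp 1)) * α) := by
  have h2 : (2 : ℝ) ≤ M.r := by exact_mod_cast two_le_r M
  have hp : (2 : ℝ) ≤ M.p := by exact_mod_cast two_le_p M
  have hil := il_pos M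
  unfold mainT
  have hpi : 0 < (M.p : ℝ) * M.intlam := by positivity
  rw [Real.log_mul hpi.ne' hα.ne', Real.log_div hδ.ne' hα.ne',
    Real.log_mul (Real.exp_pos 1).ne' hδ.ne', Real.log_div hpi.ne' (Real.exp_pos 1).ne',
    Real.log_exp, div_eq_mul_inv _ M.ψ, div_eq_mul_inv _ M.ψ, psi_inv]
  ring

end Cor3


namespace Cor3

theorem log_one_sub {x : ℝ} (h0 : 0 ≤ x) (h1 : x ≤ 1 / 2) : -(2 * x) ≤ Real.log (1 - x) := by
  have h := Real.one_sub_inv_le_log_of_pos (show 0 < 1 - x by linarith)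
  refine le_trans ?_ h
  have : (1 - x)⁻¹ ≤ 1 + 2 * x := by
    rw [inv_le_iff_one_le_mul₀ (by linarith)]; nlinarith
  linarith

theorem choose_bound (E v : ℕ) (hv : 1 ≤ v) (h2 : 2 * v ≤ E) :
    1 / (E.choose v : ℝ) ≤ Real.exp (v * Real.log (v / E) - v + Real.log v + 1
      + 2 * (v : ℝ) ^ 2 / E) := by
  have hvR : (0 : ℝ) < v := by exact_mod_cast hv
  have hER : (0 : ℝ) < E := by exact_mod_cast (by omega : 0 < E)
  have h2R : 2 * (v : ℝ) ≤ E := by exact_mod_cast h2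
  have hch : (0 : ℝ) < E.choose v := by exact_mod_cast Nat.choose_pos (by omega)
  rw [← Real.log_le_iff_le_exp (by positivity), one_div, Real.log_inv]
  have h3 := Nat.pow_le_choose (α := ℝ) v E
  have h4 : ((E : ℝ) - v) ^ v / (v.factorial : ℝ) ≤ E.choose v := by
    refine le_trans ?_ h3
    refine div_le_div_of_nonneg_right (pow_le_pow_left₀ (by linarith) ?_ _) (by positivity)
    rw [Nat.cast_sub (by omega)]; push_cast; linarith
  have h5 : 0 < (E : ℝ) - v := by linarith
  have h6 := Real.log_le_log (by positivity) h4
  rw [Real.log_div (by positivity) (by positivity), Real.log_pow] at h6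
  have h7 : Real.log ((E : ℝ) - v) = Real.log E + Real.log (1 - v / E) := by
    rw [← Real.log_mul hER.ne' (by
      have : (v : ℝ) / E ≤ 1 / 2 := by rw [div_le_iff₀ hER]; linarith
      linarith)]
    congr 1; field_simp
  have h8 := log_one_sub (x := (v : ℝ) / E) (by positivity) (by rw [div_le_iff₀ hER]; linarith)
  have h9 := log_fact_upper v hv
  rw [Real.log_div hvR.ne' hER.ne']
  have h10 : (v : ℝ) * (-(2 * (v / E))) ≤ v * Real.log (1 - v / E) :=
    mul_le_mul_of_nonneg_left h8 hvR.le
  have h11 : 2 * (v : ℝ) ^ 2 / E = - (v * (-(2 * (v / E)))) := by ring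
  rw [h11]
  rw [h7] at h6
  nlinarith

noncomputable def DA (M : DGLDPC) (κ : ℝ) : ℝ :=
  ∑ t, M.ρ t / M.s t * ∑ u ∈ Finset.range (M.s t + 1), (M.A t u : ℝ) * κ ^ ((u : ℝ) / M.r)

theorem DA_nonneg (M : DGLDPC) (κ : ℝ) (hκ : 0 ≤ κ) : 0 ≤ DA M κ := by
  refine Finset.sum_nonneg fun t _ => mul_nonneg (div_nonneg (M.hρpos t).le (by positivity))
    (Finset.sum_nonneg fun u _ => mul_nonneg (by positivity) (Real.rpow_nonneg hκ _))

theorem A_eval_bound (M : DGLDPC) (t : Fin M.nc) (κ α x : ℝ) (hα : 0 < α) (hα1 : α ≤ 1)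
    (hx : 0 < x) (hxκ : x ≤ κ * α) :
    (M.Apoly t).eval (x ^ (1 / (M.r : ℝ))) ≤ 1 + M.A t M.r * x +
      (∑ u ∈ Finset.range (M.s t + 1), (M.A t u : ℝ) * κ ^ ((u : ℝ) / M.r)) * α ^ M.ξexp := by
  have h2 := two_le_r M
  have h2R : (2 : ℝ) ≤ M.r := by exact_mod_cast h2
  have hκ : 0 < κ := by
    by_contra h
    push Not at h
    nlinarith
  have hxi : 0 < α ^ M.ξexp := Real.rpow_pos_of_pos hα _
  have hz : ∀ u : ℕ, (x ^ (1 / (M.r : ℝ))) ^ u = x ^ ((u : ℝ) / M.r) := by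
    intro u
    rw [← Real.rpow_natCast, ← Real.rpow_mul hx.le]; congr 1; ring
  unfold DGLDPC.Apoly
  rw [eval_finsetSum, Finset.sum_mul]
  simp only [eval_mul, eval_C, eval_pow, eval_X, hz]
  have key : ∀ u ∈ Finset.range (M.s t + 1), (M.A t u : ℝ) * x ^ ((u : ℝ) / M.r) ≤
      (if u = 0 then 1 else 0) + (if u = M.r then M.A t M.r * x else 0) +
        (M.A t u : ℝ) * κ ^ ((u : ℝ) / M.r) * α ^ M.ξexp := by
    intro u _
    have hpos : 0 ≤ (M.A t u : ℝ) * κ ^ ((u : ℝ) / M.r) * α ^ M.ξexp := by positivity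
    by_cases hu0 : u = 0
    · subst hu0
      have : ¬ (0 = M.r) := by omega
      simp [M.hA0, this]; positivity
    by_cases hur : u = M.r
    · subst hur
      rw [if_neg hu0, if_pos rfl, div_self (by linarith), Real.rpow_one]
      rw [div_self (by linarith)] at hpos
      linarith
    rw [if_neg hu0, if_neg hur, zero_add, zero_add]
    rcases Nat.eq_zero_or_pos (M.A t u) with h | h
    · simp [h]
    have hlt : M.r < u := by
      by_contra hc
      have := A_zero M t u hu0 (by omega)
      omega
    rw [mul_assoc]
    refine mul_le_mul_of_nonneg_left ?_ (by positivity)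
    calc x ^ ((u : ℝ) / M.r) ≤ (κ * α) ^ ((u : ℝ) / M.r) :=
          Real.rpow_le_rpow hx.le hxκ (by positivity)
      _ = κ ^ ((u : ℝ) / M.r) * α ^ ((u : ℝ) / M.r) := Real.mul_rpow hκ.le hα.le
      _ ≤ _ := mul_le_mul_of_nonneg_left (rpow_xi_le hα hα1 (xi_le_A M t u hlt h)) (by positivity)
  refine (Finset.sum_le_sum key).trans ?_
  rw [Finset.sum_add_distrib, Finset.sum_add_distrib, Finset.sum_ite_eq', Finset.sum_ite_eq']
  refine add_le_add (add_le_add ?_ ?_) le_rfl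
  · split_ifs <;> norm_num
  · split_ifs
    · exact le_rfl
    · positivity

theorem Nc_bound (M : DGLDPC) (c : Fin M.nc → ℕ) (E α κ : ℝ) (v : ℕ) (hE : 0 < E)
    (hc : ∀ t, (c t : ℝ) = E * M.ρ t / M.s t) (hv : 1 ≤ v) (hα : 0 < α) (hα1 : α ≤ 1)
    (hκ : v / E ≤ κ * α) :
    (∏ t, M.Apoly t ^ c t).coeff v ≤ Real.exp ((v / M.r) * (Real.log M.Cparam - Real.log (v / E))
      + v / M.r + E * DA M (κ / M.Cparam) * α ^ M.ξexp) := by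
  have hC := C_pos M
  have h2R : (2 : ℝ) ≤ M.r := by exact_mod_cast two_le_r M
  have hvR : (0 : ℝ) < v := by exact_mod_cast hv
  set x : ℝ := v / E / M.Cparam with hxdef
  have hx : 0 < x := by positivity
  have hxκ : x ≤ κ / M.Cparam * α := by
    rw [hxdef, div_mul_eq_mul_div]; gcongr
  set z := x ^ (1 / (M.r : ℝ)) with hz
  have hz0 : 0 < z := Real.rpow_pos_of_pos hx _
  have h1 := nn_eval (nn_P M c) hz0.le v
  have h3 : (∏ t, M.Apoly t ^ c t).eval z ≤
      Real.exp (v / M.r + E * DA M (κ / M.Cparam) * α ^ M.ξexp) := by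
    rw [eval_prod]
    have h4 : ∀ t ∈ Finset.univ, (M.Apoly t ^ c t).eval z ≤ Real.exp (c t * (M.A t M.r * x +
      (∑ u ∈ Finset.range (M.s t + 1), (M.A t u : ℝ) * (κ / M.Cparam) ^ ((u : ℝ) / M.r))
        * α ^ M.ξexp)) := by
      intro t _
      rw [eval_pow, Real.exp_nat_mul]
      refine pow_le_pow_left₀ ?_ ?_ _
      · have := nn_eval (nn_Apoly M t) hz0.le 0
        rw [coeff_Apoly, M.hA0] at this
        simp at this; linarith
      · refine (A_eval_bound M t _ α x hα hα1 hx hxκ).trans ?_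
        have := Real.add_one_le_exp (M.A t M.r * x +
          (∑ u ∈ Finset.range (M.s t + 1), (M.A t u : ℝ) * (κ / M.Cparam) ^ ((u : ℝ) / M.r))
            * α ^ M.ξexp)
        linarith
    refine (Finset.prod_le_prod (fun t _ => ?_) h4).trans ?_
    · rw [eval_pow]
      refine pow_nonneg ?_ _
      have := nn_eval (nn_Apoly M t) hz0.le 0
      rw [coeff_Apoly, M.hA0] at this
      simp at this; linarith
    · rw [← Real.exp_sum]
      apply le_of_eq
      congr 1
      have e1 : (v : ℝ) / M.r = E * x * ∑ t, M.ρ t * (M.A t M.r : ℝ) / (M.s t : ℝ) := by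
        have := C_eq M
        have hS : ∑ t, M.ρ t * (M.A t M.r : ℝ) / (M.s t : ℝ) = M.Cparam / M.r := by
          rw [this]; field_simp
        rw [hS, hxdef]; field_simp
      rw [e1, DA, Finset.mul_sum, Finset.mul_sum, Finset.sum_mul, ← Finset.sum_add_distrib]
      refine Finset.sum_congr rfl fun t _ => ?_
      rw [hc]; ring
  have h5 : z ^ v = Real.exp (v / M.r * (Real.log (v / E) - Real.log M.Cparam)) := by
    rw [hz, ← Real.rpow_natCast, ← Real.rpow_mul hx.le, Real.rpow_def_of_pos hx, hxdef,
      Real.log_div (by positivity) hC.ne']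
    congr 1; ring
  have h6 := h1.trans h3
  rw [h5, ← le_div_iff₀ (Real.exp_pos _), ← Real.exp_sub] at h6
  refine h6.trans (le_of_eq ?_)
  congr 1; ring

theorem Nv_bound (M : DGLDPC) (hk : ∀ t, M.kdim t = 1) (hpd : ∀ t, M.pd t = M.q t)
    (hB : ∀ t u v, M.B t u v = if (u = 0 ∧ v = 0) ∨ (u = 1 ∧ v = M.q t) then 1 else 0)
    (c : Fin M.nv → ℕ) (V : ℝ) (w : ℕ) (Y : ℝ) (hY : 0 < Y) (hV : 0 < V) (hw : 1 ≤ w)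
    (s : Finset ℕ) :
    ∑ v ∈ s, ((∏ t, M.Bpoly t ^ c t).coeff w).coeff v * Y ^ v ≤ Y ^ (M.p * w) *
      Real.exp (w * Real.log (V / w) + w * ∑ t, (c t / V) * Y ^ (M.q t - M.p)) := by
  have hwR : (0 : ℝ) < w := by exact_mod_cast hw
  have hbb := bb_B M hk hpd hB c
  have h1 := nn_eval_sum (P := (∏ t, M.Bpoly t ^ c t).coeff w) (fun i => (hbb w i).1) hY.le s
  refine h1.trans ?_
  have h2 : ((∏ t, M.Bpoly t ^ c t).coeff w).eval Y =
      (∏ t, (1 + C (Y ^ M.q t) * X) ^ c t : ℝ[X]).coeff w := by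
    have := coeff_map (evalRingHom Y) (p := ∏ t, M.Bpoly t ^ c t) w
    rw [coe_evalRingHom] at this
    rw [← this, Polynomial.map_prod]
    congr 1
    refine Finset.prod_congr rfl fun t _ => ?_
    rw [Bpoly_eq M hk hB]
    simp
  rw [h2]
  set x : ℝ := w / (V * Y ^ M.p) with hx
  have hx0 : 0 < x := by positivity
  have hnn : nn (∏ t, (1 + C (Y ^ M.q t) * X) ^ c t : ℝ[X]) :=
    nn_prod _ _ fun t _ => nn_pow (nn_add nn_one (by
      simpa using nn_monomial (pow_nonneg hY.le (M.q t)) 1)) _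
  have h3 := nn_eval hnn hx0.le w
  have h4 : (∏ t, (1 + C (Y ^ M.q t) * X) ^ c t : ℝ[X]).eval x ≤
      Real.exp (w * ∑ t, (c t / V) * Y ^ (M.q t - M.p)) := by
    rw [eval_prod, Finset.mul_sum, Real.exp_sum]
    refine Finset.prod_le_prod (fun t _ => ?_) fun t _ => ?_
    · simp; positivity
    · have e : (w : ℝ) * ((c t / V) * Y ^ (M.q t - M.p)) = c t * (Y ^ M.q t * x) := by
        rw [hx, show M.q t = (M.q t - M.p) + M.p from (Nat.sub_add_cancel (p_le M hpd t)).symm,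
          pow_add, Nat.add_sub_cancel]
        field_simp
      rw [e, Real.exp_nat_mul]
      simp only [eval_pow, eval_add, eval_one, eval_mul, eval_C, eval_X]
      refine pow_le_pow_left₀ (by positivity) ?_ _
      have := Real.add_one_le_exp (Y ^ M.q t * x)
      linarith
  have h5 := h3.trans h4
  rw [← le_div_iff₀ (by positivity)] at h5
  refine h5.trans (le_of_eq ?_)
  have h6 : Real.exp (w * Real.log (V / w)) = (V / w) ^ w := by
    rw [Real.exp_nat_mul, Real.exp_log (by positivity)]
  rw [Real.exp_add, h6, hx, pow_mul, div_pow, mul_pow, div_pow]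
  field_simp

end Cor3


namespace Cor3

noncomputable def DB (M : DGLDPC) (t0 : Fin M.nv) (κ : ℝ) : ℝ :=
  ∑ t, (M.lam t / M.q t) / (M.lam t0 / M.q t0) *
    Real.exp (((M.q t - M.p : ℕ) : ℝ) * (M.ψ⁻¹ * Real.log κ + Real.log M.Cparam / M.r))

theorem DB_nonneg (M : DGLDPC) (t0 : Fin M.nv) (κ : ℝ) : 0 ≤ DB M t0 κ := by
  refine Finset.sum_nonneg fun t _ => ?_
  have h1 := M.hlampos t
  have h2 := M.hlampos t0
  positivity

theorem Ysum_bound (M : DGLDPC) (hpd : ∀ t, M.pd t = M.q t)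
    (hB : ∀ t u v, M.B t u v = if (u = 0 ∧ v = 0) ∨ (u = 1 ∧ v = M.q t) then 1 else 0)
    (hinj : Function.Injective M.q) (t0 : Fin M.nv) (ht0 : M.q t0 = M.p) (κ α : ℝ) (hκ : 0 < κ)
    (hα : 0 < α) (hα1 : α ≤ 1) :
    α * ∑ t, (M.lam t / M.q t) / (M.lam t0 / M.q t0) *
      Real.exp (M.ψ⁻¹ * Real.log (κ * α) + Real.log M.Cparam / M.r) ^ (M.q t - M.p) ≤
      α + DB M t0 κ * α ^ M.ξexp := by
  have hl0 := M.hlampos t0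
  have hq0 := q_pos M t0
  have key : ∀ t ∈ Finset.univ, α * ((M.lam t / M.q t) / (M.lam t0 / M.q t0) *
      Real.exp (M.ψ⁻¹ * Real.log (κ * α) + Real.log M.Cparam / M.r) ^ (M.q t - M.p)) ≤
      (if t = t0 then α else 0) + (M.lam t / M.q t) / (M.lam t0 / M.q t0) *
    Real.exp (((M.q t - M.p : ℕ) : ℝ) * (M.ψ⁻¹ * Real.log κ + Real.log M.Cparam / M.r))
      * α ^ M.ξexp := by
    intro t _
    have hl := M.hlampos t
    by_cases h : t = t0
    · subst h
      rw [if_pos rfl, ht0, Nat.sub_self, pow_zero, mul_one]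
      rw [ht0] at hq0
      rw [div_self (by positivity)]
      have : 0 < α ^ M.ξexp := Real.rpow_pos_of_pos hα _
      simp; positivity
    · rw [if_neg h, zero_add]
      have hlt : M.p < M.q t := lt_of_le_of_ne (p_le M hpd t) fun hc => h (hinj (by rw [ht0, hc]))
      have hxi := xi_le_q M hpd hB t0 ht0 t hlt
      have e : α * Real.exp (M.ψ⁻¹ * Real.log (κ * α) + Real.log M.Cparam / M.r) ^ (M.q t - M.p) =
          Real.exp (((M.q t - M.p : ℕ) : ℝ) * (M.ψ⁻¹ * Real.log κ + Real.log M.Cparam / M.r))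
          * α ^ (((M.q t : ℝ) - M.p) / M.ψ + 1) := by
        rw [← Real.exp_nat_mul, Real.rpow_def_of_pos hα, ← Real.exp_add]
        nth_rewrite 1 [← Real.exp_log hα]
        rw [← Real.exp_add, Real.log_mul hκ.ne' hα.ne', Nat.cast_sub hlt.le]
        congr 1; ring
      have h2 := rpow_xi_le hα hα1 hxi
      calc _ = (M.lam t / M.q t) / (M.lam t0 / M.q t0) * (α *
            Real.exp (M.ψ⁻¹ * Real.log (κ * α) + Real.log M.Cparam / M.r) ^ (M.q t - M.p)) := by
            ring
        _ = (M.lam t / M.q t) / (M.lam t0 / M.q t0) * 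
          Real.exp (((M.q t - M.p : ℕ) : ℝ) * (M.ψ⁻¹ * Real.log κ + Real.log M.Cparam / M.r))
          * α ^ (((M.q t : ℝ) - M.p) / M.ψ + 1) := by rw [e]; ring
        _ ≤ _ := mul_le_mul_of_nonneg_left h2 (by positivity)
  rw [Finset.mul_sum]
  refine (Finset.sum_le_sum key).trans (le_of_eq ?_)
  rw [Finset.sum_add_distrib, Finset.sum_ite_eq', if_pos (Finset.mem_univ _), DB, Finset.sum_mul]

/-- convexity step -/
theorem phi_bound (θ r L v a E b : ℝ) (hθ : 0 ≤ θ) (hE : 0 < E) (ha : 0 < a) (hav : a ≤ v)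
    (hvb : v / E ≤ b) :
    θ * (v * (Real.log (v / E) - 1)) + (v / r) * L ≤
      θ * (a * (Real.log (a / E) - 1)) + (a / r) * L + (v - a) * (θ * Real.log b + L / r) := by
  have hv : 0 < v := by linarith
  have h1 : Real.log (v / a) ≤ v / a - 1 := Real.log_le_sub_one_of_pos (by positivity)
  have h2 : a * Real.log (v / a) ≤ v - a := by
    have := mul_le_mul_of_nonneg_left h1 ha.le
    have e : a * (v / a - 1) = v - a := by field_simp
    linarith
  have h3 : Real.log (v / a) = Real.log (v / E) - Real.log (a / E) := by
    rw [Real.log_div hv.ne' ha.ne', Real.log_div hv.ne' hE.ne', Real.log_div ha.ne' hE.ne']; ring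
  rw [h3] at h2
  have h4 : Real.log (v / E) ≤ Real.log b := Real.log_le_log (by positivity) hvb
  have h5 : (v - a) * Real.log (v / E) ≤ (v - a) * Real.log b :=
    mul_le_mul_of_nonneg_left h4 (by linarith)
  have h6 : v * (Real.log (v / E) - 1) - a * (Real.log (a / E) - 1) ≤ (v - a) * Real.log b := by
    nlinarith
  have h7 := mul_le_mul_of_nonneg_left h6 hθ
  have e : (v / r) * L = (a / r) * L + (v - a) * (L / r) := by ring
  rw [e]
  nlinarith

set_option maxHeartbeats 1000000 in
theorem upper (M : DGLDPC) (hk : ∀ t, M.kdim t = 1) (hpd : ∀ t, M.pd t = M.q t)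
    (hB : ∀ t u v, M.B t u v = if (u = 0 ∧ v = 0) ∨ (u = 1 ∧ v = M.q t) then 1 else 0)
    (hinj : Function.Injective M.q) (t0 : Fin M.nv) (ht0 : M.q t0 = M.p) :
    ∃ k : ℝ, 0 < k ∧ ∃ ε : ℝ, 0 < ε ∧ ε ≤ 1 ∧ ε * (Qm M * M.intlam) ≤ 1 / 2 ∧
      ∀ α : ℝ, 0 < α → α ≤ ε → ∀ n, M.Adm α n →
      M.grSeq α n ≤ mainT M (M.δfrac t0) α + k * α ^ M.ξexp + (1 + Real.log (M.En n)) / n := by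
  have hil := il_pos M
  have hC := C_pos M
  have hpsi := psi_pos M
  have hp2 := two_le_p M
  have hr2 : (2 : ℝ) ≤ M.r := by exact_mod_cast two_le_r M
  have hQm : M.p ≤ Qm M := ht0 ▸ q_le_Qm M t0
  have hQmR : (0 : ℝ) < Qm M := by exact_mod_cast (by omega : 0 < Qm M)
  set κ : ℝ := Qm M * M.intlam with hκdef
  have hκ : 0 < κ := by positivity
  set D2 : ℝ := DA M (κ / M.Cparam) + 2 * κ ^ 2 with hD2
  have hDA := DA_nonneg M (κ / M.Cparam) (by positivity)
  have hDB := DB_nonneg M t0 κ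
  refine ⟨D2 / M.intlam + DB M t0 κ, by positivity, min 1 (1 / (2 * κ)), by positivity,
    min_le_left _ _, ?_, ?_⟩
  · calc min 1 (1 / (2 * κ)) * κ ≤ 1 / (2 * κ) * κ :=
          mul_le_mul_of_nonneg_right (min_le_right _ _) hκ.le
      _ = 1 / 2 := by field_simp
  intro α hα hαε n hn
  obtain ⟨hn0, hE, hc, hv, hw, hpos⟩ := hn
  have hα1 : α ≤ 1 := hαε.trans (min_le_left _ _)
  have hκα : κ * α ≤ 1 / 2 := by
    calc κ * α ≤ κ * (1 / (2 * κ)) :=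
          mul_le_mul_of_nonneg_left (hαε.trans (min_le_right _ _)) hκ.le
      _ = 1 / 2 := by field_simp
  have hnR : (0 : ℝ) < n := by exact_mod_cast hn0
  unfold DGLDPC.grSeq
  set w := ⌊α * (n : ℝ)⌋₊ with hwdef
  have hwR : (0 : ℝ) < w := by rw [hw]; positivity
  have hw1 : 1 ≤ w := by exact_mod_cast hwR
  have hER : (0 : ℝ) < M.En n := by rw [hE]; positivity
  set E : ℝ := (M.En n : ℝ) with hEdef
  have hwE : (w : ℝ) / E = α * M.intlam := by rw [hw, hE]; field_simp
  set L := Real.log M.Cparam with hL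
  set y : ℝ := M.ψ⁻¹ * Real.log (κ * α) + L / M.r with hy
  set a : ℝ := (M.p : ℝ) * w with ha
  have ha0 : 0 < a := by
    have : (0 : ℝ) < M.p := by exact_mod_cast (by omega : 0 < M.p)
    positivity
  have hxi : 0 < α ^ M.ξexp := Real.rpow_pos_of_pos hα _
  set K : ℝ := M.ψ⁻¹ * (a * (Real.log (a / E) - 1)) + (a / M.r) * L + E * D2 * α ^ M.ξexp
    + 1 + Real.log E with hK
  have hbb := bb_B M hk hpd hB (M.vExp n)
  have hterm : ∀ v ∈ Finset.range (M.En n + 1),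
      M.NvCount n w v * M.NcCount n v / ((M.En n).choose v : ℝ) ≤
      (((∏ t, M.Bpoly t ^ M.vExp n t).coeff w).coeff v * Real.exp y ^ v) *
        Real.exp (K - a * y) := by
    intro v hvr
    by_cases hz : M.NvCount n w v = 0
    · have hz' := hz
      unfold DGLDPC.NvCount at hz'
      rw [hz, hz']; simp
    have hsup := (hbb w v).2 hz
    have hnonneg := (hbb w v).1
    have hvR : (v : ℝ) ≤ Qm M * w := by exact_mod_cast hsup.2
    have hav : a ≤ v := by rw [ha]; exact_mod_cast hsup.1
    have hv0 : (0 : ℝ) < v := by linarith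
    have hv1 : 1 ≤ v := by exact_mod_cast hv0
    have hvE : (v : ℝ) / E ≤ κ * α := by
      calc (v : ℝ) / E ≤ Qm M * w / E := by gcongr
        _ = κ * α := by rw [mul_div_assoc, hwE, hκdef]; ring
    have hvE2 : 2 * (v : ℝ) ≤ E := by
      have := hvE.trans hκα
      rw [div_le_iff₀ hER] at this; linarith
    have hvE2' : 2 * v ≤ M.En n := by rw [hEdef] at hvE2; exact_mod_cast hvE2
    have h1 := Nc_bound M (M.cExp n) E α κ v hER hc hv1 hα hα1 hvE
    have h2 := choose_bound (M.En n) v hv1 hvE2'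
    rw [← hEdef] at h2
    have h3 : (∏ t, M.Apoly t ^ M.cExp n t).coeff v * (1 / ((M.En n).choose v : ℝ)) ≤
        Real.exp ((v / M.r) * (L - Real.log (v / E))
      + v / M.r + E * DA M (κ / M.Cparam) * α ^ M.ξexp) * Real.exp (v * Real.log (v / E) - v
      + Real.log v + 1 + 2 * (v : ℝ) ^ 2 / E) :=
      mul_le_mul h1 h2 (by positivity) (Real.exp_pos _).le
    rw [← Real.exp_add] at h3
    have h4 := phi_bound M.ψ⁻¹ M.r L v a E (κ * α) (by positivity) hER ha0 hav hvE
    have h5 : 2 * (v : ℝ) ^ 2 / E ≤ 2 * κ ^ 2 * E * α ^ M.ξexp := by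
      have hα2 : α ^ 2 ≤ α ^ M.ξexp := by
        have := rpow_xi_le hα hα1 (xi_le_two M)
        rwa [Real.rpow_two] at this
      calc 2 * (v : ℝ) ^ 2 / E = 2 * (v / E) ^ 2 * E := by field_simp
        _ ≤ 2 * (κ * α) ^ 2 * E := by gcongr
        _ = 2 * κ ^ 2 * E * α ^ 2 := by ring
        _ ≤ _ := mul_le_mul_of_nonneg_left hα2 (by positivity)
    have h6 : Real.log v ≤ Real.log E := Real.log_le_log hv0 (by linarith)
    have h7 : (∏ t, M.Apoly t ^ M.cExp n t).coeff v * (1 / ((M.En n).choose v : ℝ)) ≤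
        Real.exp (K + (v - a) * y) := by
      refine h3.trans (Real.exp_le_exp.mpr ?_)
      have e : M.ψ⁻¹ * (v * (Real.log (v / E) - 1)) + (v / M.r) * L =
        (v / M.r) * (L - Real.log (v / E)) + v / M.r + (v * Real.log (v / E) - v) := by
        rw [psi_inv]; ring
      rw [e] at h4
      rw [hK, hD2]
      have e3 : E * (DA M (κ / M.Cparam) + 2 * κ ^ 2) * α ^ M.ξexp =
        E * DA M (κ / M.Cparam) * α ^ M.ξexp + 2 * κ ^ 2 * E * α ^ M.ξexp := by ring
      rw [e3]
      linarith [h4, h5, h6]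
    have e2 : Real.exp (K + (v - a) * y) = Real.exp y ^ v * Real.exp (K - a * y) := by
      rw [← Real.exp_nat_mul, ← Real.exp_add]; congr 1; ring
    rw [e2] at h7
    unfold DGLDPC.NvCount DGLDPC.NcCount
    calc _ = ((∏ t, M.Bpoly t ^ M.vExp n t).coeff w).coeff v *
          ((∏ t, M.Apoly t ^ M.cExp n t).coeff v * (1 / ((M.En n).choose v : ℝ))) := by ring
      _ ≤ ((∏ t, M.Bpoly t ^ M.vExp n t).coeff w).coeff v *
          (Real.exp y ^ v * Real.exp (K - a * y)) := mul_le_mul_of_nonneg_left h7 hnonneg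
      _ = _ := by ring
  have hl0 := M.hlampos t0
  have hq0 := q_pos M t0
  set V : ℝ := E * M.lam t0 / M.q t0 with hV
  have hV0 : 0 < V := by positivity
  have hsum := Nv_bound M hk hpd hB (M.vExp n) V w (Real.exp y) (Real.exp_pos _) hV0 hw1
    (Finset.range (M.En n + 1))
  have hENw : M.ENw n w ≤ Real.exp (K + (w * Real.log (V / w) + w * ∑ t, (M.vExp n t / V) *
      Real.exp y ^ (M.q t - M.p))) := by
    unfold DGLDPC.ENw
    refine (Finset.sum_le_sum hterm).trans ?_
    rw [← Finset.sum_mul]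
    refine (mul_le_mul_of_nonneg_right hsum (Real.exp_pos _).le).trans (le_of_eq ?_)
    rw [← Real.exp_nat_mul, ← Real.exp_add, ← Real.exp_add]
    congr 1
    rw [ha]; push_cast; ring
  have hlog := (Real.log_le_iff_le_exp hpos).mpr hENw
  have hY := Ysum_bound M hpd hB hinj t0 ht0 κ α hκ hα hα1
  have hs : ∑ t, (M.vExp n t / V) * Real.exp y ^ (M.q t - M.p) =
      ∑ t, (M.lam t / M.q t) / (M.lam t0 / M.q t0) *
      Real.exp (M.ψ⁻¹ * Real.log (κ * α) + L / M.r) ^ (M.q t - M.p) := by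
    refine Finset.sum_congr rfl fun t _ => ?_
    rw [hv t, hV]
    congr 1
    have := q_pos M t
    field_simp
  rw [← hs] at hY
  set Sg := ∑ t, (M.vExp n t / V) * Real.exp y ^ (M.q t - M.p)
  have hVw : V / w = M.δfrac t0 / α := by
    unfold DGLDPC.δfrac
    rw [hV, hE, hw]; field_simp
  have haE : a / E = M.p * M.intlam * α := by
    rw [ha, mul_div_assoc, hwE]; ring
  have hmain : K + (w * Real.log (V / w) + w * Sg) =
      n * (mainT M (M.δfrac t0) α - α) + E * D2 * α ^ M.ξexp + 1 + Real.log E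
        + n * (α * Sg) := by
    rw [hK, hVw, haE, mainT, ha, hw]
    ring
  rw [hmain] at hlog
  have hfin : Real.log (M.ENw n w) ≤ n * (mainT M (M.δfrac t0) α +
      (D2 / M.intlam + DB M t0 κ) * α ^ M.ξexp + (1 + Real.log E) / n) := by
    have e1 : n * (mainT M (M.δfrac t0) α +
      (D2 / M.intlam + DB M t0 κ) * α ^ M.ξexp + (1 + Real.log E) / n) =
      n * mainT M (M.δfrac t0) α + E * D2 * α ^ M.ξexp + n * (DB M t0 κ * α ^ M.ξexp)
        + (1 + Real.log E) := by
      rw [hE]; field_simp; ring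
    rw [e1]
    have := mul_le_mul_of_nonneg_left hY hnR.le
    linarith
  rw [one_div, inv_mul_le_iff₀ hnR]
  exact hfin

end Cor3


namespace Cor3

theorem Nv_lower (M : DGLDPC) (hk : ∀ t, M.kdim t = 1) (hpd : ∀ t, M.pd t = M.q t)
    (hB : ∀ t u v, M.B t u v = if (u = 0 ∧ v = 0) ∨ (u = 1 ∧ v = M.q t) then 1 else 0)
    (t0 : Fin M.nv) (ht0 : M.q t0 = M.p) (c : Fin M.nv → ℕ) (w : ℕ) :
    ((c t0).choose w : ℝ) ≤ ((∏ t, M.Bpoly t ^ c t).coeff w).coeff (M.p * w) := by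
  have hbb : ∀ t, bb M.p (Qm M) (M.Bpoly t ^ c t) := fun t => bb_pow (by
    rw [Bpoly_eq M hk hB]; exact bb_lin (p_le M hpd t) (q_le_Qm M t)) _
  rw [← Finset.mul_prod_erase _ _ (Finset.mem_univ t0)]
  have h := bb_super (hbb t0) (bb_prod (Finset.univ.erase t0) _ fun t _ => hbb t)
    w (M.p * w) 0 0
  simp only [add_zero] at h
  refine le_trans (le_of_eq ?_) h
  have h1 : (∏ t ∈ Finset.univ.erase t0, M.Bpoly t ^ c t).coeff 0 = 1 := by
    rw [coeff_zero_eq_eval_zero, eval_prod]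
    refine Finset.prod_eq_one fun t _ => ?_
    rw [Bpoly_eq M hk hB]; simp
  have h2 : (M.Bpoly t0 ^ c t0).coeff w = C ((c t0).choose w : ℝ) * X ^ (M.p * w) := by
    rw [Bpoly_eq M hk hB, ht0]
    have : (1 + C (X ^ M.p : ℝ[X]) * X) ^ c t0 = ((1 + X) ^ c t0 : ℝ[X][X]).comp (C (X ^ M.p) * X) := by
      simp
    rw [this, comp_C_mul_X_coeff, coeff_one_add_X_pow, ← pow_mul]
    simp
  rw [h1, h2, coeff_C_mul, coeff_X_pow_self]; simp

theorem Nc_lower (M : DGLDPC) (c : Fin M.nc → ℕ) (A : ℝ) (hA : 0 ≤ A)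
    (hAt : ∀ t, (M.A t M.r : ℝ) ≤ A) (u : ℕ)
    (hu : A * u ≤ ∑ t, (c t : ℝ) * M.A t M.r) :
    (∑ t, (c t : ℝ) * M.A t M.r - A * u) ^ u / (u.factorial : ℝ) ≤
      (∏ t, M.Apoly t ^ c t).coeff (u * M.r) := by
  have hr := two_le_r M
  set F : ℝ[X] := ∏ t, (1 + C (M.A t M.r : ℝ) * X) ^ c t with hF
  have hR : RR A F (∑ t, (c t : ℝ) * M.A t M.r) :=
    RR_prod _ _ _ fun t _ => RR_pow (RR_lin (by positivity) (hAt t)) _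
  have h0 : F.coeff 0 = 1 := by
    rw [coeff_zero_eq_eval_zero, hF, eval_prod]
    exact Finset.prod_eq_one fun t _ => by simp
  refine (RR_lower hA hR h0 u hu u le_rfl).trans ?_
  rw [← coeff_expand_mul (by omega : 0 < M.r) F u]
  have e : expand ℝ M.r F = ∏ t, (1 + C (M.A t M.r : ℝ) * X ^ M.r) ^ c t := by
    rw [hF, map_prod]
    refine Finset.prod_congr rfl fun t _ => ?_
    simp
  rw [e]
  have hn1 : ∀ t, nn (1 + C (M.A t M.r : ℝ) * X ^ M.r) := fun t =>
    nn_add nn_one (nn_monomial (by positivity) _)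
  have hn2 : ∀ t, nn (M.Apoly t - (1 + C (M.A t M.r : ℝ) * X ^ M.r)) := by
    intro t i
    rw [coeff_sub, coeff_add, coeff_one, coeff_C_mul_X_pow, coeff_Apoly]
    by_cases h0 : i = 0
    · subst h0
      rw [if_pos rfl, if_neg (by omega), M.hA0]; simp
    · rw [if_neg h0]
      split_ifs with h
      · rw [h]; simp
      · simp
  have := cle_prod Finset.univ (fun t => (1 + C (M.A t M.r : ℝ) * X ^ M.r) ^ c t)
    (fun t => M.Apoly t ^ c t) (fun t _ => nn_pow (hn1 t) _) (fun t _ => by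
      have h := cle_prod (Finset.range (c t)) (fun _ => 1 + C (M.A t M.r : ℝ) * X ^ M.r)
        (fun _ => M.Apoly t) (fun _ _ => hn1 t) (fun _ _ => hn2 t)
      simpa using h) (u * M.r)
  rw [coeff_sub] at this
  linarith

theorem mult_adm (M : DGLDPC) (α : ℝ) (n0 N : ℕ) (h : M.Adm α n0) :
    M.En (N * n0) = N * M.En n0 ∧ (∀ t, M.cExp (N * n0) t = N * M.cExp n0 t) ∧
    (∀ t, M.vExp (N * n0) t = N * M.vExp n0 t) ∧
    ⌊α * ((N * n0 : ℕ) : ℝ)⌋₊ = N * ⌊α * (n0 : ℝ)⌋₊ := by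
  obtain ⟨hn0, hE, hc, hv, hw, hpos⟩ := h
  have h1 : M.En (N * n0) = N * M.En n0 := by
    have : ((N * n0 : ℕ) : ℝ) / M.intlam = ((N * M.En n0 : ℕ) : ℝ) := by
      push_cast; rw [hE]; ring
    conv_lhs => unfold DGLDPC.En
    rw [this, Nat.floor_natCast]
  refine ⟨h1, fun t => ?_, fun t => ?_, ?_⟩
  · have : (M.En (N * n0) : ℝ) * M.ρ t / M.s t = ((N * M.cExp n0 t : ℕ) : ℝ) := by
      rw [h1]; push_cast; rw [hc]; ring
    conv_lhs => unfold DGLDPC.cExp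
    rw [this, Nat.floor_natCast]
  · have : (M.En (N * n0) : ℝ) * M.lam t / M.q t = ((N * M.vExp n0 t : ℕ) : ℝ) := by
      rw [h1]; push_cast; rw [hv]; ring
    conv_lhs => unfold DGLDPC.vExp
    rw [this, Nat.floor_natCast]
  · have : α * ((N * n0 : ℕ) : ℝ) = ((N * ⌊α * (n0 : ℝ)⌋₊ : ℕ) : ℝ) := by
      push_cast; rw [hw]; ring
    rw [this, Nat.floor_natCast]

theorem Nv_nonneg (M : DGLDPC) (hk : ∀ t, M.kdim t = 1) (hpd : ∀ t, M.pd t = M.q t)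
    (hB : ∀ t u v, M.B t u v = if (u = 0 ∧ v = 0) ∨ (u = 1 ∧ v = M.q t) then 1 else 0)
    (n w v : ℕ) : 0 ≤ M.NvCount n w v := (bb_B M hk hpd hB (M.vExp n) w v).1

theorem Nc_nonneg (M : DGLDPC) (n v : ℕ) : 0 ≤ M.NcCount n v := nn_P M (M.cExp n) v

theorem ENw_ge (M : DGLDPC) (hk : ∀ t, M.kdim t = 1) (hpd : ∀ t, M.pd t = M.q t)
    (hB : ∀ t u v, M.B t u v = if (u = 0 ∧ v = 0) ∨ (u = 1 ∧ v = M.q t) then 1 else 0)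
    (n w v : ℕ) (hv : v ≤ M.En n) :
    M.NvCount n w v * M.NcCount n v / ((M.En n).choose v : ℝ) ≤ M.ENw n w := by
  unfold DGLDPC.ENw
  exact Finset.single_le_sum
    (f := fun v => M.NvCount n w v * M.NcCount n v / ((M.En n).choose v : ℝ))
    (fun v _ => div_nonneg (mul_nonneg (Nv_nonneg M hk hpd hB n w v) (Nc_nonneg M n v))
      (by positivity)) (Finset.mem_range.mpr (by omega))

theorem log_pow_sub (V x : ℝ) (w : ℕ) (hV : 0 < V) (hx : 0 ≤ x) (h : x / V ≤ 1 / 2) :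
    0 < V - x ∧ w * (Real.log V - 2 * (x / V)) ≤ Real.log ((V - x) ^ w) := by
  have h1 : V - x = V * (1 - x / V) := by field_simp
  have h2 : 0 < 1 - x / V := by linarith
  have h3 : 0 < V - x := by rw [h1]; positivity
  refine ⟨h3, ?_⟩
  rw [Real.log_pow, h1, Real.log_mul hV.ne' h2.ne']
  have := log_one_sub (div_nonneg hx hV.le) h
  exact mul_le_mul_of_nonneg_left (by linarith) (by positivity)

set_option maxHeartbeats 1000000 in
theorem lower (M : DGLDPC) (hk : ∀ t, M.kdim t = 1) (hpd : ∀ t, M.pd t = M.q t)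
    (hB : ∀ t u v, M.B t u v = if (u = 0 ∧ v = 0) ∨ (u = 1 ∧ v = M.q t) then 1 else 0)
    (t0 : Fin M.nv) (ht0 : M.q t0 = M.p) :
    ∃ k : ℝ, 0 < k ∧ ∃ ε : ℝ, 0 < ε ∧
      ∀ α : ℝ, 0 < α → α ≤ ε → ∀ n0, M.Adm α n0 → ∀ m, 1 ≤ m →
      M.Adm α (m * M.r * n0) ∧
      mainT M (M.δfrac t0) α - k * α ^ 2
        - (2 + 2 * Real.log (M.p * ((m * M.r * n0 : ℕ) : ℝ))) / ((m * M.r * n0 : ℕ) : ℝ) ≤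
        M.grSeq α (m * M.r * n0) := by
  have hil := il_pos M
  have hC := C_pos M
  have hpsi := psi_pos M
  have hp2 : (2 : ℝ) ≤ M.p := by exact_mod_cast two_le_p M
  have hr2 : (2 : ℝ) ≤ M.r := by exact_mod_cast two_le_r M
  have hr2' := two_le_r M
  have hl0 := M.hlampos t0
  have hq0 := q_pos M t0
  have hδ : 0 < M.δfrac t0 := by unfold DGLDPC.δfrac; positivity
  set δ := M.δfrac t0 with hδdef
  set A : ℝ := 1 + ∑ t, (M.A t M.r : ℝ) with hAdef
  have hA : 0 < A := by positivity
  have hAt : ∀ t, (M.A t M.r : ℝ) ≤ A := fun t => by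
    have := Finset.single_le_sum (f := fun t => (M.A t M.r : ℝ)) (fun _ _ => by positivity)
      (Finset.mem_univ t)
    rw [hAdef]; linarith
  set b : ℝ := A * M.p * M.intlam / M.Cparam with hb
  have hb0 : 0 < b := by positivity
  refine ⟨2 / δ + 2 * b * M.p / M.r, by positivity, min (1 / 2) (min (δ / 2) (1 / (2 * b))),
    by positivity, ?_⟩
  intro α hα hαε n0 hn0 m hm
  have hα1 : α ≤ 1 / 2 := hαε.trans (min_le_left _ _)
  have hαδ : α ≤ δ / 2 := hαε.trans ((min_le_right _ _).trans (min_le_left _ _))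
  have hαb : b * α ≤ 1 / 2 := by
    have : α ≤ 1 / (2 * b) := hαε.trans ((min_le_right _ _).trans (min_le_right _ _))
    calc b * α ≤ b * (1 / (2 * b)) := mul_le_mul_of_nonneg_left this hb0.le
      _ = 1 / 2 := by field_simp
  obtain ⟨hmE, hmc, hmv, hmw⟩ := mult_adm M α n0 (m * M.r) hn0
  obtain ⟨hn0p, hE, hc, hv, hw, hpos⟩ := hn0
  set n := m * M.r * n0 with hn
  set w0 := ⌊α * (n0 : ℝ)⌋₊ with hw0
  have hmr : 0 < m * M.r := Nat.mul_pos (by omega) (by omega)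
  have hnpos : 0 < n := Nat.mul_pos hmr hn0p
  have hnR : (0 : ℝ) < n := by exact_mod_cast hnpos
  have hE' : (M.En n : ℝ) = n / M.intlam := by
    rw [hmE, hn]; push_cast; rw [hE]; ring
  have hc' : ∀ t, (M.cExp n t : ℝ) = M.En n * M.ρ t / M.s t := fun t => by
    rw [hmc, hmE]; push_cast; rw [hc]; ring
  have hv' : ∀ t, (M.vExp n t : ℝ) = M.En n * M.lam t / M.q t := fun t => by
    rw [hmv, hmE]; push_cast; rw [hv]; ring
  set w := ⌊α * (n : ℝ)⌋₊ with hwdef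
  have hw' : (w : ℝ) = α * n := by
    rw [hmw, hn]; push_cast; rw [hw]; ring
  set u := M.p * m * w0 with hu
  have huv : u * M.r = M.p * w := by rw [hmw, hu]; ring
  have huvR : (u : ℝ) * M.r = M.p * w := by exact_mod_cast huv
  have huR : (u : ℝ) = M.p * α * n / M.r := by
    rw [eq_div_iff (by positivity), huvR, hw']; ring
  have hw0R : (0 : ℝ) < w := by rw [hw']; positivity
  have hu0R : (0 : ℝ) < u := by rw [huR]; positivity
  have hw1 : 1 ≤ w := by exact_mod_cast hw0R
  have hu1 : 1 ≤ u := by exact_mod_cast hu0R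
  have hER : (0 : ℝ) < M.En n := by rw [hE']; positivity
  have hVδ : (M.vExp n t0 : ℝ) = δ * n := by
    rw [hv', hE', hδdef]; unfold DGLDPC.δfrac; field_simp
  have hV0 : (0 : ℝ) < M.vExp n t0 := by rw [hVδ]; positivity
  have hwV : (w : ℝ) / M.vExp n t0 = α / δ := by rw [hw', hVδ]; field_simp
  have hwV2 : (w : ℝ) / M.vExp n t0 ≤ 1 / 2 := by
    rw [hwV, div_le_iff₀ hδ]; linarith
  set S : ℝ := ∑ t, (M.cExp n t : ℝ) * M.A t M.r with hS
  have hSeq : S = n * M.Cparam / (M.r * M.intlam) := by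
    have : S = M.En n * ∑ t, M.ρ t * (M.A t M.r : ℝ) / (M.s t : ℝ) := by
      rw [hS, Finset.mul_sum]
      refine Finset.sum_congr rfl fun t _ => ?_
      rw [hc']; ring
    rw [this, C_eq M, hE']; field_simp
  have hS0 : 0 < S := by rw [hSeq]; positivity
  have huS : A * u / S = b * α := by rw [huR, hSeq, hb]; field_simp
  have huS2 : A * u / S ≤ 1 / 2 := by rw [huS]; exact hαb
  -- the pieces
  obtain ⟨hVw, hlV⟩ := log_pow_sub (M.vExp n t0) w w hV0 hw0R.le hwV2
  obtain ⟨hSu, hlS⟩ := log_pow_sub S (A * u) u hS0 (by positivity) huS2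
  have hNc : (S - A * u) ^ u / (u.factorial : ℝ) ≤ M.NcCount n (M.p * w) := by
    rw [← huv]
    exact Nc_lower M (M.cExp n) A hA.le hAt u (by rw [← hS]; linarith)
  have hNv : ((M.vExp n t0 : ℝ) - w) ^ w / (w.factorial : ℝ) ≤ M.NvCount n w (M.p * w) := by
    refine le_trans ?_ (Nv_lower M hk hpd hB t0 ht0 (M.vExp n) w)
    refine le_trans ?_ (Nat.pow_le_choose (α := ℝ) w (M.vExp n t0))
    refine div_le_div_of_nonneg_right (pow_le_pow_left₀ hVw.le ?_ _) (by positivity)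
    have : w ≤ M.vExp n t0 := by
      have : (w : ℝ) ≤ M.vExp n t0 := by linarith
      exact_mod_cast this
    rw [Nat.cast_sub (by omega)]; push_cast; linarith
  have hvE : M.p * w ≤ M.En n := by
    have h1 : (M.q t0 : ℝ) * M.vExp n t0 ≤ M.En n := by
      have hle : M.lam t0 ≤ 1 := by
        rw [← M.hlamsum]
        exact Finset.single_le_sum (f := M.lam) (fun t _ => (M.hlampos t).le) (Finset.mem_univ t0)
      rw [hv']
      calc (M.q t0 : ℝ) * (M.En n * M.lam t0 / M.q t0) = M.En n * M.lam t0 := by field_simp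
        _ ≤ M.En n * 1 := mul_le_mul_of_nonneg_left hle hER.le
        _ = _ := mul_one _
    have h2 : (M.p : ℝ) * w ≤ M.En n := by
      rw [ht0] at h1
      refine le_trans (mul_le_mul_of_nonneg_left (by linarith) (by linarith)) h1
    exact_mod_cast h2
  have hchp : (0 : ℝ) < (M.En n).choose (M.p * w) := by exact_mod_cast Nat.choose_pos hvE
  have hch := Nat.choose_le_pow_div (α := ℝ) (M.p * w) (M.En n)
  have hge := ENw_ge M hk hpd hB n w (M.p * w) hvE
  set v := M.p * w with hvdef
  have hvR : (v : ℝ) = M.p * α * n := by rw [hvdef]; push_cast; rw [hw']; ring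
  have hv0R : (0 : ℝ) < v := by rw [hvR]; positivity
  have hv1 : 1 ≤ v := by exact_mod_cast hv0R
  have hbig : (((M.vExp n t0 : ℝ) - w) ^ w / (w.factorial : ℝ)) *
      ((S - A * u) ^ u / (u.factorial : ℝ)) / ((M.En n : ℝ) ^ v / v.factorial) ≤ M.ENw n w := by
    refine le_trans ?_ hge
    have hN0 : 0 ≤ ((M.vExp n t0 : ℝ) - w) ^ w / (w.factorial : ℝ) := by positivity
    have hN1 : 0 ≤ (S - A * u) ^ u / (u.factorial : ℝ) := by positivity
    exact div_le_div₀ (mul_nonneg (hN0.trans hNv) (hN1.trans hNc))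
      (mul_le_mul hNv hNc hN1 (hN0.trans hNv)) hchp hch
  have hposn : 0 < M.ENw n w := lt_of_lt_of_le (by positivity) hbig
  refine ⟨⟨hnpos, hE', hc', hv', hw', hposn⟩, ?_⟩
  have hlog := Real.log_le_log (by positivity) hbig
  rw [Real.log_div (by positivity) (by positivity), Real.log_mul (by positivity) (by positivity),
    Real.log_div (by positivity) (by positivity), Real.log_div (by positivity) (by positivity),
    Real.log_div (by positivity) (by positivity), Real.log_pow (n := v)] at hlog
  have hf1 := log_fact_upper w hw1
  have hf2 := log_fact_upper u hu1
  have hf3 := log_fact_lower v hv1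
  have hlw : Real.log w ≤ Real.log (M.p * n) := by
    refine Real.log_le_log hw0R ?_
    rw [hw']; nlinarith
  have hlu : Real.log u ≤ Real.log (M.p * n) := by
    refine Real.log_le_log hu0R ?_
    rw [huR, div_le_iff₀ (by positivity)]
    have : 0 < (M.p : ℝ) * n := by positivity
    nlinarith
  have e1 : Real.log w = Real.log (M.vExp n t0) - Real.log (δ / α) := by
    rw [← Real.log_div hV0.ne' (by positivity), hVδ, hw']
    congr 1; field_simp
  have e2 : Real.log u = Real.log S - (Real.log M.Cparam - Real.log (M.p * M.intlam * α)) := by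
    rw [← Real.log_div hC.ne' (by positivity), ← Real.log_div hS0.ne' (by positivity), huR, hSeq]
    congr 1; field_simp
  have e3 : Real.log v = Real.log (M.En n) + Real.log (M.p * M.intlam * α) := by
    rw [← Real.log_mul hER.ne' (by positivity), hvR, hE']
    congr 1; field_simp
  unfold DGLDPC.grSeq
  rw [one_div, ← div_eq_inv_mul, le_div_iff₀ hnR]
  have hgoal : (mainT M δ α - (2 / δ + 2 * b * M.p / M.r) * α ^ 2
      - (2 + 2 * Real.log (M.p * (n : ℝ))) / n) * n =
      (w * (Real.log (M.vExp n t0) - 2 * (w / M.vExp n t0)) -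
        (w * Real.log w - w)) + (u * (Real.log S - 2 * (A * u / S)) - (u * Real.log u - u))
        - (v * Real.log (M.En n) - (v * Real.log v - v)) - (2 + 2 * Real.log (M.p * (n : ℝ))) := by
    have hx : ((2 + 2 * Real.log (M.p * (n : ℝ))) / n) * n = 2 + 2 * Real.log (M.p * (n : ℝ)) := by
      field_simp
    rw [sub_mul, hx, e1, e2, e3, hwV, huS, hw', huR, hvR, mainT, div_eq_mul_inv _ M.ψ, psi_inv]
    field_simp
    ring
  rw [hgoal]
  linarith

end Cor3


namespace Cor3

theorem choose_upper (N V : ℕ) (hV : V ≤ N) (x : ℝ) (h0 : 0 < x) (h1 : x < 1) :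
    Real.log (N.choose V : ℝ) + V * Real.log x + ((N : ℝ) - V) * Real.log (1 - x) ≤ 0 := by
  have hch : (0 : ℝ) < N.choose V := by exact_mod_cast Nat.choose_pos hV
  have hx1 : 0 < 1 - x := by linarith
  have h := add_pow x (1 - x) N
  rw [show x + (1 - x) = 1 by ring, one_pow] at h
  have h2 := Finset.single_le_sum
    (f := fun m => x ^ m * (1 - x) ^ (N - m) * (N.choose m : ℝ))
    (fun m _ => by positivity) (Finset.mem_range.mpr (by omega : V < N + 1))
  rw [← h] at h2
  have h3 := Real.log_le_log (by positivity) h2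
  rw [Real.log_one, Real.log_mul (by positivity) (by positivity),
    Real.log_mul (by positivity) (by positivity), Real.log_pow, Real.log_pow,
    Nat.cast_sub hV] at h3
  linarith

theorem choose_lower (E v : ℕ) (hv : 1 ≤ v) (hvE : v < E) :
    - (v * Real.log ((v : ℝ) / E) + ((E : ℝ) - v) * Real.log (1 - (v : ℝ) / E)) ≤
      Real.log (E.choose v : ℝ) + 2 + 2 * Real.log (E + 1) := by
  have hvR : (0 : ℝ) < v := by exact_mod_cast hv
  have hvER : (v : ℝ) < E := by exact_mod_cast hvE
  have hER : (0 : ℝ) < E := by linarith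
  have hd : (0 : ℝ) < (E : ℝ) - v := by linarith
  have e1 : 1 - (v : ℝ) / E = (E - v) / E := by field_simp
  rw [e1, Real.log_div hvR.ne' hER.ne', Real.log_div hd.ne' hER.ne']
  have h1 := log_fact_lower E (by omega)
  have h2 := log_fact_upper v hv
  have h3 := log_fact_upper (E - v) (by omega)
  rw [Nat.cast_sub hvE.le] at h3
  have h4 : Real.log (E.factorial : ℝ) = Real.log (E.choose v : ℝ) + Real.log (v.factorial : ℝ)
      + Real.log ((E - v).factorial : ℝ) := by
    have hch : (0 : ℝ) < E.choose v := by exact_mod_cast Nat.choose_pos hvE.le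
    rw [← Real.log_mul (by positivity) (by positivity), ← Real.log_mul (by positivity)
      (by positivity)]
    congr 1
    exact_mod_cast (Nat.choose_mul_factorial_mul_factorial hvE.le).symm
  have h5 : Real.log v ≤ Real.log (E + 1) := Real.log_le_log hvR (by linarith)
  have h6 : Real.log ((E : ℝ) - v) ≤ Real.log (E + 1) := Real.log_le_log hd (by linarith)
  linarith

theorem log_En_tendsto (M : DGLDPC) :
    Tendsto (fun n : ℕ => Real.log ((M.En n : ℝ) + 1) / n) atTop (nhds 0) := by
  have hil := il_pos M
  have h0 : Tendsto (fun n : ℕ => Real.log (n : ℝ) / n) atTop (nhds 0) :=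
    (Real.isLittleO_log_id_atTop.tendsto_div_nhds_zero).comp tendsto_natCast_atTop_atTop
  have h1 : Tendsto (fun n : ℕ => Real.log (1 / M.intlam + 1) / (n : ℝ)) atTop (nhds 0) :=
    tendsto_const_nhds.div_atTop tendsto_natCast_atTop_atTop
  have h2 := h0.add h1
  rw [add_zero] at h2
  refine squeeze_zero' ?_ ?_ h2
  · filter_upwards with n
    exact div_nonneg (Real.log_nonneg (by linarith [(M.En n).cast_nonneg (α := ℝ)])) (by positivity)
  · filter_upwards [eventually_ge_atTop 1] with n hn
    have hnR : (1 : ℝ) ≤ n := by exact_mod_cast hn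
    rw [← add_div]
    refine div_le_div_of_nonneg_right ?_ (by positivity)
    rw [← Real.log_mul (by positivity) (by positivity)]
    refine Real.log_le_log (by positivity) ?_
    have : (M.En n : ℝ) ≤ n / M.intlam := Nat.floor_le (by positivity)
    calc (M.En n : ℝ) + 1 ≤ n / M.intlam + n := by linarith
      _ = _ := by ring

theorem log_pn_tendsto (p : ℝ) (hp : 0 < p) :
    Tendsto (fun n : ℕ => (2 + 2 * Real.log (p * (n : ℝ))) / n) atTop (nhds 0) := by
  have h0 : Tendsto (fun n : ℕ => Real.log (n : ℝ) / n) atTop (nhds 0) :=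
    (Real.isLittleO_log_id_atTop.tendsto_div_nhds_zero).comp tendsto_natCast_atTop_atTop
  have h1 : Tendsto (fun n : ℕ => (2 + 2 * Real.log p) / (n : ℝ)) atTop (nhds 0) :=
    tendsto_const_nhds.div_atTop tendsto_natCast_atTop_atTop
  have h2 := (h0.const_mul 2).add h1
  rw [mul_zero, add_zero] at h2
  refine h2.congr' ?_
  filter_upwards [eventually_ge_atTop 1] with n hn
  have hnR : (1 : ℝ) ≤ n := by exact_mod_cast hn
  rw [Real.log_mul hp.ne' (by positivity)]
  ring

theorem exists_term (M : DGLDPC) (n w : ℕ) (h : 0 < M.ENw n w) :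
    ∃ v ≤ M.En n, M.ENw n w / ((M.En n : ℝ) + 1) ≤
      M.NvCount n w v * M.NcCount n v / ((M.En n).choose v : ℝ) := by
  by_contra hc
  push Not at hc
  have : M.ENw n w < ∑ _v ∈ Finset.range (M.En n + 1), M.ENw n w / ((M.En n : ℝ) + 1) := by
    conv_lhs => unfold DGLDPC.ENw
    refine Finset.sum_lt_sum_of_nonempty ⟨0, by simp⟩ fun v hv => ?_
    have hlt := hc v (by rw [Finset.mem_range] at hv; omega)
    exact hlt
  rw [Finset.sum_const, Finset.card_range, nsmul_eq_mul] at this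
  push_cast at this
  have hp : (0 : ℝ) < (M.En n : ℝ) + 1 := by positivity
  rw [mul_div_cancel₀ _ hp.ne'] at this
  exact lt_irrefl _ this

noncomputable def er (M : DGLDPC) (n : ℕ) : ℝ := (2 + 3 * Real.log ((M.En n : ℝ) + 1)) / n

set_option maxHeartbeats 1000000 in
theorem superadd (M : DGLDPC) (hk : ∀ t, M.kdim t = 1) (hpd : ∀ t, M.pd t = M.q t)
    (hB : ∀ t u v, M.B t u v = if (u = 0 ∧ v = 0) ∨ (u = 1 ∧ v = M.q t) then 1 else 0)
    (α : ℝ) (hα : 0 < α) (hα2 : α * (Qm M * M.intlam) ≤ 1 / 2) (n : ℕ) (hn : M.Adm α n)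
    (ε : ℝ) (hε : 0 < ε) :
    ∃ N, ∀ n', M.Adm α n' → N ≤ n' → M.grSeq α n - er M n - ε ≤ M.grSeq α n' := by
  have hil := il_pos M
  obtain ⟨hn0, hE, hc, hv, hw, hpos⟩ := hn
  have hnR : (0 : ℝ) < n := by exact_mod_cast hn0
  set w := ⌊α * (n : ℝ)⌋₊ with hwdef
  obtain ⟨v, hvE, hterm⟩ := exists_term M n w hpos
  have hER : (0 : ℝ) < M.En n := by rw [hE]; positivity
  have hch : (0 : ℝ) < (M.En n).choose v := by exact_mod_cast Nat.choose_pos hvE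
  have htpos : 0 < M.NvCount n w v * M.NcCount n v / ((M.En n).choose v : ℝ) :=
    lt_of_lt_of_le (by positivity) hterm
  have hX : 0 < M.NvCount n w v * M.NcCount n v := by
    by_contra hcon
    push Not at hcon
    exact absurd htpos (not_lt.mpr (div_nonpos_of_nonpos_of_nonneg hcon hch.le))
  have hNv : 0 < M.NvCount n w v := lt_of_le_of_ne (Nv_nonneg M hk hpd hB n w v)
    fun h => by rw [← h] at hX; simp at hX
  have hNc : 0 < M.NcCount n v := lt_of_le_of_ne (Nc_nonneg M n v)
    fun h => by rw [← h] at hX; simp at hX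
  have hsup := (bb_B M hk hpd hB (M.vExp n) w v).2 hNv.ne'
  have hw0 : (0 : ℝ) < w := by rw [hw]; positivity
  have hw1 : 0 < w := by exact_mod_cast hw0
  have hp2 := two_le_p M
  have hv1 : 1 ≤ v := le_trans (Nat.mul_pos (by omega) hw1) hsup.1
  have hvR : (0 : ℝ) < v := by exact_mod_cast hv1
  have hvlt : (v : ℝ) < M.En n := by
    have h1 : (v : ℝ) ≤ Qm M * w := by exact_mod_cast hsup.2
    have h2 : (Qm M : ℝ) * w = α * (Qm M * M.intlam) * M.En n := by
      rw [hw, hE]; field_simp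
    have h3 := mul_le_mul_of_nonneg_right hα2 hER.le
    linarith
  have hvlt' : v < M.En n := by exact_mod_cast hvlt
  set x : ℝ := (v : ℝ) / M.En n with hx
  have hx0 : 0 < x := by positivity
  have hx1 : x < 1 := by rw [hx, div_lt_one hER]; exact hvlt
  set Lv : ℝ := Real.log (M.NvCount n w v * M.NcCount n v) + (v * Real.log x +
    ((M.En n : ℝ) - v) * Real.log (1 - x)) with hLv
  set g : ℝ := M.grSeq α n - er M n with hg
  have hLg : n * g ≤ Lv := by
    have h1 := Real.log_le_log (by positivity) hterm
    rw [Real.log_div hpos.ne' (by positivity), Real.log_div hX.ne' hch.ne'] at h1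
    have h2 := choose_lower (M.En n) v hv1 hvlt'
    rw [← hx] at h2
    have e : n * g = Real.log (M.ENw n w) - (2 + 3 * Real.log ((M.En n : ℝ) + 1)) := by
      rw [hg, er, DGLDPC.grSeq, ← hwdef]; field_simp
    rw [e, hLv]
    linarith
  have hres : ∀ i : ℕ, ∃ N, ∀ n', M.Adm α n' → n' % n = i → N ≤ n' → g - ε ≤ M.grSeq α n' := by
    intro i
    by_cases hj : ∃ j, M.Adm α j ∧ j % n = i
    swap
    · exact ⟨0, fun n' h1 h2 _ => absurd ⟨n', h1, h2⟩ hj⟩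
    obtain ⟨j, ⟨hj0, hEj, hcj, hvj, hwj, hposj⟩, hji⟩ := hj
    set wj := ⌊α * (j : ℝ)⌋₊ with hwjdef
    obtain ⟨vj, hvEj, htj⟩ := exists_term M j wj hposj
    have hchj : (0 : ℝ) < (M.En j).choose vj := by exact_mod_cast Nat.choose_pos hvEj
    have htposj : 0 < M.NvCount j wj vj * M.NcCount j vj / ((M.En j).choose vj : ℝ) :=
      lt_of_lt_of_le (by positivity) htj
    have hXj : 0 < M.NvCount j wj vj * M.NcCount j vj := by
      by_contra hcon
      push Not at hcon
      exact absurd htposj (not_lt.mpr (div_nonpos_of_nonpos_of_nonneg hcon hchj.le))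
    set cst : ℝ := Real.log (M.NvCount j wj vj * M.NcCount j vj) + (vj * Real.log x +
      ((M.En j : ℝ) - vj) * Real.log (1 - x)) with hcst
    refine ⟨max j ⌈|cst - j * g| / ε⌉₊, fun n' hn' hmod hle => ?_⟩
    have hjn : j ≤ n' := (le_max_left _ _).trans hle
    have hbig : |cst - j * g| / ε ≤ n' :=
      (Nat.le_ceil _).trans (by exact_mod_cast (le_max_right _ _).trans hle)
    obtain ⟨k, hkn⟩ : ∃ k, n' = j + k * n := by
      have : n ∣ n' - j := (Nat.modEq_iff_dvd' hjn).mp (by rw [Nat.ModEq, hji, hmod])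
      obtain ⟨k, hk'⟩ := this
      exact ⟨k, by rw [mul_comm k n, ← hk']; omega⟩
    obtain ⟨hn0', hE', hc', hv', hw', hpos'⟩ := hn'
    set w' := ⌊α * (n' : ℝ)⌋₊ with hwdef'
    have hknR : (n' : ℝ) = j + k * n := by rw [hkn]; push_cast; ring
    have aE : M.En n' = M.En j + k * M.En n := by
      have : (M.En n' : ℝ) = M.En j + k * M.En n := by rw [hE', hEj, hE, hknR]; ring
      exact_mod_cast this
    have aER : (M.En n' : ℝ) = M.En j + k * M.En n := by rw [aE]; push_cast; ring
    have aw : w' = wj + k * w := by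
      have : (w' : ℝ) = wj + k * w := by rw [hw', hwj, hw, hknR]; ring
      exact_mod_cast this
    have ac : ∀ t, M.cExp n' t = M.cExp j t + k * M.cExp n t := fun t => by
      have : (M.cExp n' t : ℝ) = M.cExp j t + k * M.cExp n t := by
        rw [hc', hcj, hc, aER]; ring
      exact_mod_cast this
    have av : ∀ t, M.vExp n' t = M.vExp j t + k * M.vExp n t := fun t => by
      have : (M.vExp n' t : ℝ) = M.vExp j t + k * M.vExp n t := by
        rw [hv', hvj, hv, aER]; ring
      exact_mod_cast this
    have hNc' : M.NcCount j vj * M.NcCount n v ^ k ≤ M.NcCount n' (vj + k * v) := by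
      have e : ∏ t, M.Apoly t ^ M.cExp n' t =
          (∏ t, M.Apoly t ^ M.cExp j t) * (∏ t, M.Apoly t ^ M.cExp n t) ^ k := by
        rw [← Finset.prod_pow, ← Finset.prod_mul_distrib]
        refine Finset.prod_congr rfl fun t _ => ?_
        rw [ac, pow_add, mul_comm k, pow_mul]
      unfold DGLDPC.NcCount
      rw [e]
      exact (mul_le_mul_of_nonneg_left (nn_super_pow (nn_P M (M.cExp n)) v k)
        (nn_P M (M.cExp j) vj)).trans
        (nn_super (nn_P M (M.cExp j)) (nn_pow (nn_P M (M.cExp n)) k) _ _)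
    have hNv' : M.NvCount j wj vj * M.NvCount n w v ^ k ≤ M.NvCount n' w' (vj + k * v) := by
      have e : ∏ t, M.Bpoly t ^ M.vExp n' t =
          (∏ t, M.Bpoly t ^ M.vExp j t) * (∏ t, M.Bpoly t ^ M.vExp n t) ^ k := by
        rw [← Finset.prod_pow, ← Finset.prod_mul_distrib]
        refine Finset.prod_congr rfl fun t _ => ?_
        rw [av, pow_add, mul_comm k, pow_mul]
      have b1 := bb_B M hk hpd hB (M.vExp n)
      have b2 := bb_B M hk hpd hB (M.vExp j)
      unfold DGLDPC.NvCount
      rw [e, aw]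
      exact (mul_le_mul_of_nonneg_left (bb_super_pow b1 w v k) (b2 wj vj).1).trans
        (bb_super b2 (bb_pow b1 k) _ _ _ _)
    have hVle : vj + k * v ≤ M.En n' := by
      rw [aE]
      exact Nat.add_le_add hvEj (Nat.mul_le_mul_left k hvE)
    have hge := ENw_ge M hk hpd hB n' w' (vj + k * v) hVle
    have hch' : (0 : ℝ) < (M.En n').choose (vj + k * v) := by
      exact_mod_cast Nat.choose_pos hVle
    have hprod : (M.NvCount j wj vj * M.NcCount j vj) * (M.NvCount n w v * M.NcCount n v) ^ k ≤
        M.NvCount n' w' (vj + k * v) * M.NcCount n' (vj + k * v) := by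
      have h1 := mul_le_mul hNv' hNc' (mul_nonneg (Nc_nonneg M j vj) (pow_nonneg hNc.le k))
        (Nv_nonneg M hk hpd hB n' w' _)
      refine le_trans (le_of_eq ?_) h1
      rw [mul_pow]; ring
    have hlow : (M.NvCount j wj vj * M.NcCount j vj) * (M.NvCount n w v * M.NcCount n v) ^ k /
        ((M.En n').choose (vj + k * v) : ℝ) ≤ M.ENw n' w' :=
      (div_le_div_of_nonneg_right hprod hch'.le).trans hge
    have hlog := Real.log_le_log (by positivity) hlow
    rw [Real.log_div (by positivity) hch'.ne', Real.log_mul hXj.ne' (by positivity),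
      Real.log_pow] at hlog
    have hcu := choose_upper (M.En n') (vj + k * v) hVle x hx0 hx1
    rw [aER] at hcu
    push_cast at hcu
    have hfinal : cst + k * Lv ≤ Real.log (M.ENw n' w') := by
      rw [hcst, hLv]
      linarith
    have hkL : (k : ℝ) * (n * g) ≤ k * Lv := mul_le_mul_of_nonneg_left hLg (by positivity)
    have hn0R' : (0 : ℝ) < n' := by exact_mod_cast hn0'
    rw [div_le_iff₀ hε] at hbig
    have habs := neg_abs_le (cst - j * g)
    unfold DGLDPC.grSeq
    rw [one_div, ← div_eq_inv_mul, le_div_iff₀ hn0R', ← hwdef']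
    have e5 : (g - ε) * n' = j * g + k * (n * g) - n' * ε := by
      have : (n' : ℝ) * g = j * g + k * (n * g) := by rw [hknR]; ring
      linarith
    rw [e5]
    linarith
  choose f hf using hres
  refine ⟨(Finset.range n).sup f, fun n' hn' hle => hf (n' % n) n' hn' rfl ?_⟩
  exact (Finset.le_sup (f := f) (Finset.mem_range.mpr (Nat.mod_lt _ hn0))).trans hle

end Cor3

/-- **Corollary 3** (GLDPC ensembles).  Suppose every VN type is a repetition code:
`k_t = 1`, `B^{(t)}(x,y) = 1 + x y^{q_t}` and `p_t = q_t`, with pairwise distinct degrees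
`q_t`; let `p = min_t q_t` and let `δ~ = δ_{t₀}` be the fraction of VNs of the unique
minimum-degree type `t₀`.  If `r > 2` or `p > 2`, then
`G(α) = (p - p/r - 1) α log α + K α + O(α^ξ)` with
`K = log(e δ~) + (p/r) log C + (p/ψ) log(p ∫λ / e)`. -/
theorem cor3_GLDPC (M : DGLDPC)
    (hk : ∀ t, M.kdim t = 1)
    (hpd : ∀ t, M.pd t = M.q t)
    (hB : ∀ t u v, M.B t u v = if (u = 0 ∧ v = 0) ∨ (u = 1 ∧ v = M.q t) then 1 else 0)
    (hinj : Function.Injective M.q)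
    (t0 : Fin M.nv) (ht0 : M.q t0 = M.p)
    (h : 2 < M.r ∨ 2 < M.p) :
    ∃ k : ℝ, 0 < k ∧ ∃ ε : ℝ, 0 < ε ∧
      ∀ α : ℝ, 0 < α → α ≤ ε → {n : ℕ | M.Adm α n}.Infinite →
        ∃ G : ℝ,
          Filter.Tendsto (M.grSeq α)
            (Filter.atTop ⊓ Filter.principal {n : ℕ | M.Adm α n}) (nhds G) ∧
          |G - (((M.p : ℝ) - (M.p : ℝ) / (M.r : ℝ) - 1) * α * Real.log α +
              (Real.log (Real.exp 1 * M.δfrac t0) +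
                ((M.p : ℝ) / (M.r : ℝ)) * Real.log M.Cparam +
                ((M.p : ℝ) / M.ψ) * Real.log ((M.p : ℝ) * M.intlam / Real.exp 1)) * α)| ≤
            k * α ^ M.ξexp := by
  obtain ⟨k1, hk1, ε1, hε1, hε1', hεQ, hup⟩ := Cor3.upper M hk hpd hB hinj t0 ht0
  obtain ⟨k2, hk2, ε2, hε2, hlow⟩ := Cor3.lower M hk hpd hB t0 ht0
  have hil := Cor3.il_pos M
  refine ⟨k1 + k2, by positivity, min ε1 ε2, lt_min hε1 hε2, ?_⟩
  intro α hα hαε hinf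
  have ha1 : α ≤ ε1 := hαε.trans (min_le_left _ _)
  have ha2 : α ≤ ε2 := hαε.trans (min_le_right _ _)
  have hα1 : α ≤ 1 := ha1.trans hε1'
  have hξ : (0 : ℝ) ≤ α ^ M.ξexp := Real.rpow_nonneg hα.le _
  have hαQ : α * (Cor3.Qm M * M.intlam) ≤ 1 / 2 := by
    refine le_trans ?_ hεQ
    gcongr
  have hinv : Tendsto (fun n : ℕ => (1 : ℝ) / n) atTop (nhds 0) :=
    tendsto_one_div_atTop_nhds_zero_nat
  have hlogT := Cor3.log_En_tendsto M
  have her0 : Tendsto (Cor3.er M) atTop (nhds 0) := by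
    have h3 := (hinv.const_mul 2).add (hlogT.const_mul 3)
    simp only [mul_zero, add_zero] at h3
    refine h3.congr (fun n => ?_)
    rw [Cor3.er]; ring
  have hl0 : ∀ n, 0 ≤ Real.log ((M.En n : ℝ) + 1) := fun n =>
    Real.log_nonneg (by have : (0 : ℝ) ≤ M.En n := Nat.cast_nonneg _; linarith)
  have her : ∀ n, 0 ≤ Cor3.er M n := by
    intro n
    have := hl0 n
    rw [Cor3.er]; positivity
  have hupT : Tendsto (fun n : ℕ => Cor3.mainT M (M.δfrac t0) α + k1 * α ^ M.ξexp +
      (1 + Real.log (M.En n)) / n) (atTop ⊓ principal {n : ℕ | M.Adm α n})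
      (nhds (Cor3.mainT M (M.δfrac t0) α + k1 * α ^ M.ξexp)) := by
    have h4 : Tendsto (fun n : ℕ => (1 + Real.log (M.En n)) / n) atTop (nhds 0) := by
      have h3 := hinv.add hlogT
      simp only [add_zero] at h3
      refine squeeze_zero (fun n => ?_) (fun n => ?_) h3
      · have := Real.log_natCast_nonneg (M.En n)
        positivity
      · rw [← add_div]
        rcases Nat.eq_zero_or_pos (M.En n) with h0 | h0
        · simp [h0]
        · have h0' : (0 : ℝ) < M.En n := by exact_mod_cast h0
          have := Real.log_le_log h0' (by linarith : (M.En n : ℝ) ≤ M.En n + 1)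
          gcongr
    have h5 := (h4.mono_left (inf_le_left : atTop ⊓ principal {n : ℕ | M.Adm α n} ≤ atTop)).const_add
      (Cor3.mainT M (M.δfrac t0) α + k1 * α ^ M.ξexp)
    rwa [add_zero] at h5
  have hne : NeBot (atTop ⊓ principal {n : ℕ | M.Adm α n}) :=
    frequently_mem_iff_neBot.1 (Nat.frequently_atTop_iff_infinite.2 hinf)
  obtain ⟨G, hG⟩ := Cor3.limit_exists {n : ℕ | M.Adm α n} (M.grSeq α) (Cor3.er M)
    hinf.nonempty her her0
    (Cor3.mainT M (M.δfrac t0) α + k1 * α ^ M.ξexp + (1 + 1 / M.intlam))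
    (by
      intro n hn
      have h6 := hup α hα ha1 n hn
      have hn1 : (1 : ℝ) ≤ n := by exact_mod_cast hn.1
      have hEn := hn.2.1
      have hE0 : (0 : ℝ) < M.En n := by rw [hEn]; positivity
      have h7 : Real.log (M.En n) ≤ M.En n := (Real.log_le_sub_one_of_pos hE0).trans (by linarith)
      have h8 : (1 + Real.log (M.En n)) / n ≤ 1 + 1 / M.intlam := by
        rw [div_le_iff₀ (by linarith)]
        have : (1 + 1 / M.intlam) * n = n + n / M.intlam := by ring
        rw [this, ← hEn]; linarith
      linarith)
    (fun n hn ε hε => Cor3.superadd M hk hpd hB α hα hαQ n hn ε hε)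
  refine ⟨G, hG, ?_⟩
  have hδ : 0 < M.δfrac t0 := by
    have h1 := M.hlampos t0
    have h2 : (0 : ℝ) < M.q t0 := by exact_mod_cast M.h_q1 t0
    rw [DGLDPC.δfrac]; positivity
  rw [← Cor3.main_eq M (M.δfrac t0) α hδ hα]
  have hU : G ≤ Cor3.mainT M (M.δfrac t0) α + k1 * α ^ M.ξexp := by
    refine le_of_tendsto_of_tendsto hG hupT ?_
    have : ∀ᶠ n in atTop ⊓ principal {n : ℕ | M.Adm α n}, n ∈ {n : ℕ | M.Adm α n} :=
      mem_inf_of_right (mem_principal_self _)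
    filter_upwards [this] with n hn using hup α hα ha1 n hn
  have hL : Cor3.mainT M (M.δfrac t0) α - k2 * α ^ 2 ≤ G := by
    obtain ⟨n0, hn0⟩ := hinf.nonempty
    have hr := Cor3.two_le_r M
    have hp : 0 < (M.p : ℝ) := by
      have := Cor3.two_le_p M
      exact_mod_cast (by omega : 0 < M.p)
    have hmapA : Tendsto (fun m : ℕ => (m + 1) * M.r * n0) atTop atTop := by
      refine tendsto_atTop_mono (fun m => ?_) tendsto_id
      have h1 : 1 ≤ M.r * n0 := Nat.mul_pos (by omega) hn0.1
      show m ≤ _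
      rw [mul_assoc]
      nlinarith
    have hmap : Tendsto (fun m : ℕ => (m + 1) * M.r * n0) atTop
        (atTop ⊓ principal {n : ℕ | M.Adm α n}) := by
      refine tendsto_inf.2 ⟨hmapA, tendsto_principal.2 (Eventually.of_forall fun m => ?_)⟩
      exact (hlow α hα ha2 n0 hn0 (m + 1) (by omega)).1
    have h1 := hG.comp hmap
    have h2 := ((Cor3.log_pn_tendsto M.p hp).comp hmapA).const_sub
      (Cor3.mainT M (M.δfrac t0) α - k2 * α ^ 2)
    rw [sub_zero] at h2
    exact le_of_tendsto_of_tendsto' h2 h1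
      (fun m => (hlow α hα ha2 n0 hn0 (m + 1) (by omega)).2)
  have hsq : α ^ 2 ≤ α ^ M.ξexp := by
    have := Cor3.rpow_xi_le hα hα1 (Cor3.xi_le_two M)
    rwa [Real.rpow_two] at this
  have h9 : k2 * α ^ 2 ≤ k2 * α ^ M.ξexp := by gcongr
  have h10 : 0 ≤ k1 * α ^ M.ξexp := by positivity
  have h11 : 0 ≤ k2 * α ^ M.ξexp := by positivity
  rw [abs_le]
  constructor <;> linarith
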